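/- arXiv:1304.2163 — 5 statements merged into one kernel-verified Lean document; each statement's English description precedes it below -/
import Mathlib

section
/- Let I ⊆ ℝ be an interval, let n ≥ 1, and let g₀, …, g_n : I → ℝ be continuous functions with g_n(m) ≠ 0 for all m ∈ I. Set G_m(x) = g_n(m)xⁿ + … + g₁(m)x + g₀(m), and let c, d : I → ℝ be continuous with c(m) < d(m) for all m ∈ I. Assume: (i) for some m₀ ∈ I, G_{m₀} has exactly r zeros in the open interval (c(m₀), d(m₀)), all of them simple; (ii) G_m(c(m))·G_m(d(m)) ≠ 0 for all m ∈ I; (iii) for all m ∈ I, G_m has no repeated complex root, i.e. the resultant of G_m and G_m' is nonzero (equivalently, the discriminant Δ_x(G_m) ≠ 0). Then for every m ∈ I, the polynomial G_m has exactly r zeros in (c(m), d(m)), and all of them are simple. -/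
open Set

noncomputable section

open scoped Topology
open Filter

/-- A simple zero of a member of a continuous family persists, and stays locally unique,
under small perturbations of the parameter. -/
lemma eventually_existsUnique_zero_of_simple_zero {X : Type*} [TopologicalSpace X]
    {f f' : X → ℝ → ℝ}
    (hf : Continuous (Function.uncurry f)) (hf' : Continuous (Function.uncurry f'))
    (hderiv : ∀ m t, HasDerivAt (f m) (f' m t) t) {m₁ : X} {x : ℝ}
    (hx : f m₁ x = 0) (hx' : f' m₁ x ≠ 0) {U : Set ℝ} (hU : U ∈ 𝓝 x) :
    ∃ V ⊆ U, IsOpen V ∧ x ∈ V ∧ ∀ᶠ m in 𝓝 m₁, ∃! y, y ∈ V ∧ f m y = 0 := by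
  set a := f' m₁ x with ha
  have hpos : ∀ᶠ p : X × ℝ in 𝓝 m₁ ×ˢ 𝓝 x, 0 < a * f' p.1 p.2 := by
    rw [← nhds_prod_eq]
    have hcont : Continuous fun p : X × ℝ => a * f' p.1 p.2 := continuous_const.mul hf'
    exact hcont.continuousAt.eventually (lt_mem_nhds (by simpa [← ha] using mul_self_pos.2 hx'))
  obtain ⟨p, hp, q, hq, hpq⟩ := eventually_prod_iff.1 hpos
  obtain ⟨δ, hδ, hball⟩ := Metric.nhds_basis_closedBall.mem_iff.1 (inter_mem hU hq)
  rw [Real.closedBall_eq_Icc] at hball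
  have hmono : ∀ m, p m → StrictMonoOn (fun y => a * f m y) (Icc (x - δ) (x + δ)) := by
    intro m hm
    have hd : ∀ y, HasDerivAt (fun y => a * f m y) (a * f' m y) y :=
      fun y => (hderiv m y).const_mul a
    refine strictMonoOn_of_deriv_pos (convex_Icc _ _)
      (fun y _ => (hd y).continuousAt.continuousWithinAt) fun y hy => ?_
    rw [(hd y).deriv]
    exact hpq hm (hball (interior_subset hy)).2
  have hcont : ∀ y, Continuous fun m => a * f m y := fun y =>
    continuous_const.mul (hf.comp (continuous_id.prodMk continuous_const))
  have hmid : x ∈ Icc (x - δ) (x + δ) := ⟨by linarith, by linarith⟩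
  have hleft : a * f m₁ (x - δ) < 0 := by
    simpa [hx] using hmono m₁ hp.self_of_nhds ⟨le_rfl, by linarith⟩ hmid (by linarith)
  have hright : 0 < a * f m₁ (x + δ) := by
    simpa [hx] using hmono m₁ hp.self_of_nhds hmid ⟨by linarith, le_rfl⟩ (by linarith)
  refine ⟨Ioo (x - δ) (x + δ), fun y hy => (hball (Ioo_subset_Icc_self hy)).1, isOpen_Ioo,
    ⟨by linarith, by linarith⟩, ?_⟩
  filter_upwards [hp, (hcont _).continuousAt.eventually (gt_mem_nhds hleft),
    (hcont _).continuousAt.eventually (lt_mem_nhds hright)] with m hm hl hr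
  have hfm : Continuous fun y => a * f m y :=
    continuous_const.mul (hf.comp (continuous_const.prodMk continuous_id))
  obtain ⟨y, hy, hy0⟩ := intermediate_value_Ioo (by linarith : x - δ ≤ x + δ)
    hfm.continuousOn ⟨hl, hr⟩
  refine ⟨y, ⟨hy, (mul_eq_zero.1 hy0).resolve_left hx'⟩, ?_⟩
  rintro z ⟨hz, hz0⟩
  refine (hmono m hm).injOn (Ioo_subset_Icc_self hz) (Ioo_subset_Icc_self hy) ?_
  simp only [hz0, mul_zero]
  exact hy0.symm

/-- If a member of a continuous family has finitely many zeros in a compact interval, all of them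
simple and interior, then nearby members have the same number of zeros there. -/
lemma eventually_ncard_zeros_eq {X : Type*} [TopologicalSpace X] {f f' : X → ℝ → ℝ}
    (hf : Continuous (Function.uncurry f)) (hf' : Continuous (Function.uncurry f'))
    (hderiv : ∀ m t, HasDerivAt (f m) (f' m t) t) {m₁ : X} {a b : ℝ}
    (hfin : {t ∈ Icc a b | f m₁ t = 0}.Finite) (ha : f m₁ a ≠ 0) (hb : f m₁ b ≠ 0)
    (hsimple : ∀ t ∈ Icc a b, f m₁ t = 0 → f' m₁ t ≠ 0) :
    ∀ᶠ m in 𝓝 m₁, {t ∈ Icc a b | f m t = 0}.ncard = {t ∈ Icc a b | f m₁ t = 0}.ncard := by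
  set Z := {t ∈ Icc a b | f m₁ t = 0} with hZ
  obtain ⟨U, hU, hdisj⟩ := hfin.t2_separation
  have hinterior : ∀ x ∈ Z, Icc a b ∈ 𝓝 x := by
    rintro x ⟨hx, hx0⟩
    refine Icc_mem_nhds (lt_of_le_of_ne hx.1 ?_) (lt_of_le_of_ne hx.2 ?_)
    · rintro rfl; exact ha hx0
    · rintro rfl; exact hb hx0
  have hloc : ∀ x ∈ Z, ∃ V ⊆ U x ∩ Icc a b, IsOpen V ∧ x ∈ V ∧
      ∀ᶠ m in 𝓝 m₁, ∃! y, y ∈ V ∧ f m y = 0 := fun x hx =>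
    eventually_existsUnique_zero_of_simple_zero hf hf' hderiv hx.2 (hsimple x hx.1 hx.2)
      (inter_mem ((hU x).2.mem_nhds (hU x).1) (hinterior x hx))
  choose! V hVU hVo hxV hV using hloc
  have hcover : ∀ᶠ m in 𝓝 m₁, ∀ y ∈ Icc a b, f m y = 0 → ∃ x ∈ Z, y ∈ V x := by
    refine isCompact_Icc.eventually_forall_of_forall_eventually fun y hy => ?_
    by_cases hy0 : f m₁ y = 0
    · have hyZ : y ∈ Z := ⟨hy, hy0⟩
      filter_upwards [continuous_snd.continuousAt.eventually
        ((hVo y hyZ).mem_nhds (hxV y hyZ))] with p hp _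
      exact ⟨y, hyZ, hp⟩
    · filter_upwards [hf.continuousAt.eventually_ne (show Function.uncurry f (m₁, y) ≠ 0 from hy0)]
        with p hp hp0
      exact absurd hp0 hp
  filter_upwards [hcover, (eventually_all_finite hfin).2 hV] with m hm hu
  choose! φ hφ huniq using hu
  symm
  refine ncard_congr (fun x _ => φ x) (fun x hx => ?_) (fun x y hx hy hxy => ?_) fun y hy => ?_
  · exact ⟨(hVU x hx (hφ x hx).1).2, (hφ x hx).2⟩
  · by_contra hne
    refine (hdisj hx hy hne).le_bot ⟨(hVU x hx (hφ x hx).1).1, ?_⟩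
    rw [hxy]
    exact (hVU y hy (hφ y hy).1).1
  · obtain ⟨x, hx, hyx⟩ := hm y hy.1 hy.2
    exact ⟨x, hx, (huniq x hx y ⟨hyx, hy.2⟩).symm⟩


theorem zeros_of_one_parameter_family
    (I : Set ℝ) (hI : I.OrdConnected)
    (n : ℕ) (hn : 1 ≤ n)
    (g : ℕ → ℝ → ℝ) (hg : ∀ i ≤ n, ContinuousOn (g i) I)
    (hlead : ∀ m ∈ I, g n m ≠ 0)
    (G : ℝ → ℝ → ℝ)
    (hG : ∀ m x : ℝ, G m x = ∑ i ∈ Finset.range (n + 1), g i m * x ^ i)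
    (c d : ℝ → ℝ) (hc : ContinuousOn c I) (hd : ContinuousOn d I)
    (hcd : ∀ m ∈ I, c m < d m)
    (r : ℕ) (m₀ : ℝ) (hm₀ : m₀ ∈ I)
    (hzeros : {x ∈ Set.Ioo (c m₀) (d m₀) | G m₀ x = 0}.ncard = r)
    (hsimple : ∀ x ∈ Set.Ioo (c m₀) (d m₀), G m₀ x = 0 → deriv (G m₀) x ≠ 0)
    (hends : ∀ m ∈ I, G m (c m) * G m (d m) ≠ 0)
    (hdisc : ∀ m ∈ I, ∀ z : ℂ,
      (∑ i ∈ Finset.range (n + 1), (g i m : ℂ) * z ^ i) = 0 →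
      (∑ i ∈ Finset.range (n + 1), (i : ℂ) * (g i m : ℂ) * z ^ (i - 1)) ≠ 0) :
    ∀ m ∈ I, {x ∈ Set.Ioo (c m) (d m) | G m x = 0}.ncard = r ∧
      ∀ x ∈ Set.Ioo (c m) (d m), G m x = 0 → deriv (G m) x ≠ 0 := by
  have hsum_deriv : ∀ m x, HasDerivAt (G m)
      (∑ i ∈ Finset.range (n + 1), (i : ℝ) * g i m * x ^ (i - 1)) x := by
    intro m x
    rw [funext (hG m)]
    refine HasDerivAt.fun_sum fun i _ => ?_
    exact ((hasDerivAt_pow i x).const_mul (g i m)).congr_deriv (by ring)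
  have hsimple_zero : ∀ m ∈ I, ∀ x, G m x = 0 →
      (∑ i ∈ Finset.range (n + 1), (i : ℝ) * g i m * x ^ (i - 1)) ≠ 0 := by
    intro m hm x hx h0
    rw [hG] at hx
    exact hdisc m hm x (by exact_mod_cast hx) (by exact_mod_cast h0)
  have hfinite : ∀ m ∈ I, {x | G m x = 0}.Finite := by
    intro m hm
    set P : Polynomial ℝ :=
      ∑ i ∈ Finset.range (n + 1), Polynomial.C (g i m) * Polynomial.X ^ i with hP
    have hcoeff : P.coeff n = g n m := by
      simp [hP, Polynomial.finsetSum_coeff, Polynomial.coeff_C_mul, Polynomial.coeff_X_pow]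
    have hP0 : P ≠ 0 := by
      intro h
      exact hlead m hm (by rw [← hcoeff, h, Polynomial.coeff_zero])
    refine (Polynomial.finite_setOfPred_isRoot hP0).subset fun x hx => ?_
    have : G m x = 0 := hx
    simpa [hP, Polynomial.IsRoot, Polynomial.eval_finsetSum, ← hG] using this
  let L : I → ℝ → ℝ := fun m t => c m + t * (d m - c m)
  let f : I → ℝ → ℝ := fun m t => G m (L m t)
  let f' : I → ℝ → ℝ := fun m t =>
    (∑ i ∈ Finset.range (n + 1), (i : ℝ) * g i m * L m t ^ (i - 1)) * (d m - c m)
  have hc' : Continuous fun p : I × ℝ => c p.1 := hc.domRestrict.comp continuous_fst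
  have hd' : Continuous fun p : I × ℝ => d p.1 := hd.domRestrict.comp continuous_fst
  have hg' : ∀ i ∈ Finset.range (n + 1), Continuous fun p : I × ℝ => g i p.1 := fun i hi =>
    (hg i (Nat.lt_succ_iff.1 (Finset.mem_range.1 hi))).domRestrict.comp continuous_fst
  have hL : Continuous fun p : I × ℝ => L p.1 p.2 :=
    hc'.add (continuous_snd.mul (hd'.sub hc'))
  have hf : Continuous (Function.uncurry f) := by
    change Continuous fun p : I × ℝ => G p.1 (L p.1 p.2)
    simp only [hG]
    exact continuous_finsetSum _ fun i hi => (hg' i hi).mul (hL.pow i)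
  have hf' : Continuous (Function.uncurry f') :=
    (continuous_finsetSum _ fun i hi =>
      (continuous_const.mul (hg' i hi)).mul (hL.pow (i - 1))).mul (hd'.sub hc')
  have hderiv : ∀ m t, HasDerivAt (f m) (f' m t) t := by
    intro m t
    have hLd : HasDerivAt (L m) (d m - c m) t := by
      exact (((hasDerivAt_id t).mul_const (d m - c m)).const_add (c m : ℝ)).congr_deriv (one_mul _)
    exact (hsum_deriv m (L m t)).comp t hLd
  have hlen : ∀ m : I, 0 < d m - c m := fun m => sub_pos.2 (hcd m m.2)
  have hLinj : ∀ m, Function.Injective (L m) := fun m s t hst =>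
    mul_right_cancel₀ (hlen m).ne' (add_left_cancel hst)
  have hL0 : ∀ m, L m 0 = c m := fun m => by simp [L]
  have hL1 : ∀ m, L m 1 = d m := fun m => by simp [L]
  have hncard : ∀ m : I, {x ∈ Ioo (c m) (d m) | G m x = 0}.ncard =
      {t ∈ Icc (0 : ℝ) 1 | f m t = 0}.ncard := by
    intro m
    rw [← ncard_image_of_injective {t ∈ Icc (0 : ℝ) 1 | f m t = 0} (hLinj m)]
    congr 1
    ext x
    constructor
    · rintro ⟨⟨hcx, hxd⟩, hx0⟩
      have hLx : L m ((x - c m) / (d m - c m)) = x := by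
        simp only [L]
        rw [div_mul_cancel₀ _ (hlen m).ne']
        ring
      refine ⟨(x - c m) / (d m - c m), ⟨⟨div_nonneg (by linarith) (hlen m).le,
        (div_le_one (hlen m)).2 (by linarith)⟩, ?_⟩, hLx⟩
      simpa only [f, hLx] using hx0
    · rintro ⟨t, ⟨⟨ht0, ht1⟩, hft⟩, rfl⟩
      have h0 : t ≠ 0 := by
        rintro rfl
        exact left_ne_zero_of_mul (hends m m.2) (by simpa only [f, hL0] using hft)
      have h1 : t ≠ 1 := by
        rintro rfl
        exact right_ne_zero_of_mul (hends m m.2) (by simpa only [f, hL1] using hft)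
      have hpos : 0 < t := lt_of_le_of_ne ht0 h0.symm
      have hlt : t < 1 := lt_of_le_of_ne ht1 h1
      refine ⟨⟨?_, ?_⟩, hft⟩ <;> simp only [L] <;> nlinarith [hlen m]
  have hconst : IsLocallyConstant fun m : I => {t ∈ Icc (0 : ℝ) 1 | f m t = 0}.ncard := by
    refine (IsLocallyConstant.iff_eventually_eq _).2 fun m => ?_
    refine eventually_ncard_zeros_eq hf hf' hderiv ?_ ?_ ?_ ?_
    · exact ((hfinite m m.2).preimage (hLinj m).injOn).subset fun t ht => ht.2
    · simpa only [f, hL0] using left_ne_zero_of_mul (hends m m.2)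
    · simpa only [f, hL1] using right_ne_zero_of_mul (hends m m.2)
    · exact fun t _ ht => mul_ne_zero (hsimple_zero m m.2 _ ht) (hlen m).ne'
  have : PreconnectedSpace I := Subtype.preconnectedSpace hI.isPreconnected
  intro m hm
  refine ⟨?_, fun x _ hx => ?_⟩
  · rw [← hzeros, hncard ⟨m, hm⟩, hncard ⟨m₀, hm₀⟩]
    exact hconst.apply_eq_of_preconnectedSpace _ _
  · rw [(hsum_deriv m x).deriv]
    exact hsimple_zero m hm x hx

end
end

section
/- Let m ∈ ℝ and let X_m(x,y) = (y³ − x³, −x + m·y⁵). Let g₂ : ℝ → ℝ be C³, and define g₁(y) = g₂'(y), g₀(y) = (1/2)g₂''(y) − (1/2)m·y⁵·g₂'(y) + (5/3)m·y⁴·g₂(y), and V₂(x,y) = g₀(y) + g₁(y)x + g₂(y)x². Then for all (x,y) ∈ ℝ²: ⟨∇V₂(x,y), X_m(x,y)⟩ − (2/3)·V₂(x,y)·div X_m(x,y) = ( −(1/2)g₂'''(y) + (3/2)m·y⁵·g₂''(y) − (5/2)m·y⁴·g₂'(y) + (2/3)(3−10m)·y³·g₂(y) )·x + (1/18)·y³·(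 9m·y²·g₂'''(y) − m·(30 + 9m·y⁶)·y·g₂''(y) + 3·(6 + 5m²·y⁶)·g₂'(y) + 20·m²·y⁵·g₂(y) ). -/
open Real Filter Set

noncomputable section

/-- Bacciotti's system `X_m(x,y) = (y³ − x³, −x + m·y⁵)`. -/
def bacciotti (m : ℝ) (p : ℝ × ℝ) : ℝ × ℝ :=
  (p.2 ^ 3 - p.1 ^ 3, -p.1 + m * p.2 ^ 5)

theorem dulac_function_identity (m : ℝ) (g2 : ℝ → ℝ) (hg2 : ContDiff ℝ 3 g2)
    (g1 g0 : ℝ → ℝ)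
    (hg1 : g1 = deriv g2)
    (hg0 : ∀ y : ℝ, g0 y = (1 / 2) * deriv (deriv g2) y
      - (1 / 2) * m * y ^ 5 * deriv g2 y + (5 / 3) * m * y ^ 4 * g2 y)
    (V : ℝ × ℝ → ℝ)
    (hV : ∀ p : ℝ × ℝ, V p = g0 p.2 + g1 p.2 * p.1 + g2 p.2 * p.1 ^ 2) :
    ∀ x y : ℝ,
      fderiv ℝ V (x, y) (bacciotti m (x, y))
        - (2 / 3) * V (x, y) * (-3 * x ^ 2 + 5 * m * y ^ 4) =
      (-(1 / 2) * deriv (deriv (deriv g2)) y + (3 / 2) * m * y ^ 5 * deriv (deriv g2) y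
        - (5 / 2) * m * y ^ 4 * deriv g2 y + (2 / 3) * (3 - 10 * m) * y ^ 3 * g2 y) * x
      + (1 / 18) * y ^ 3 *
          (9 * m * y ^ 2 * deriv (deriv (deriv g2)) y
            - m * (30 + 9 * m * y ^ 6) * y * deriv (deriv g2) y
            + 3 * (6 + 5 * m ^ 2 * y ^ 6) * deriv g2 y
            + 20 * m ^ 2 * y ^ 5 * g2 y) := by
  intro x y
  have h0 : HasDerivAt g2 (deriv g2 y) y :=
    (hg2.differentiable (by norm_num)).differentiableAt.hasDerivAt
  have c1 : ContDiff ℝ 2 (deriv g2) := by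
    have h : ContDiff ℝ (2 + 1) g2 := by convert hg2 using 1; norm_num
    exact (contDiff_succ_iff_deriv.1 h).2.2
  have c2 : ContDiff ℝ 1 (deriv (deriv g2)) := by
    have h : ContDiff ℝ (1 + 1) (deriv g2) := by convert c1 using 1; norm_num
    exact (contDiff_succ_iff_deriv.1 h).2.2
  have h1 : HasDerivAt (deriv g2) (deriv (deriv g2) y) y :=
    (c1.differentiable (by norm_num)).differentiableAt.hasDerivAt
  have h2 : HasDerivAt (deriv (deriv g2)) (deriv (deriv (deriv g2)) y) y :=
    (c2.differentiable (by norm_num)).differentiableAt.hasDerivAt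
  have hg0' : HasDerivAt g0 ((1 / 2) * deriv (deriv (deriv g2)) y
      - ((1 / 2) * m * (5 * y ^ 4) * deriv g2 y + (1 / 2) * m * y ^ 5 * deriv (deriv g2) y)
      + ((5 / 3) * m * (4 * y ^ 3) * g2 y + (5 / 3) * m * y ^ 4 * deriv g2 y)) y := by
    rw [funext hg0]
    have h5 : HasDerivAt (fun y : ℝ => y ^ 5) (5 * y ^ 4) y := by simpa using hasDerivAt_pow 5 y
    have h4 : HasDerivAt (fun y : ℝ => y ^ 4) (4 * y ^ 3) y := by simpa using hasDerivAt_pow 4 y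
    exact ((h2.const_mul (1 / 2)).sub ((h5.const_mul ((1 / 2) * m)).mul h1)).add
      ((h4.const_mul ((5 / 3) * m)).mul h0)
  have hfst : HasFDerivAt (fun p : ℝ × ℝ => p.1) (ContinuousLinearMap.fst ℝ ℝ ℝ) (x, y) :=
    hasFDerivAt_fst
  have hsnd : HasFDerivAt (fun p : ℝ × ℝ => p.2) (ContinuousLinearMap.snd ℝ ℝ ℝ) (x, y) :=
    hasFDerivAt_snd
  have hV' := ((hg0'.comp_hasFDerivAt (x, y) hsnd).add
    ((h1.comp_hasFDerivAt (x, y) hsnd).mul hfst)).add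
    ((h0.comp_hasFDerivAt (x, y) hsnd).mul (hfst.pow 2))
  have hD := (hV'.congr_of_eventuallyEq (f₁ := V)
    (.of_forall fun p => by rw [hV, hg1]; rfl)).fderiv
  rw [hD, hV, hg0, hg1]
  simp [bacciotti]
  ring

end
end

section
/- Let m > 0 and let Ω = {(x,y) ∈ ℝ² : |x| < m^{−1/4}, |y| < m^{−1/4}, and x·y > −1}. Then every periodic orbit γ of Bacciotti's system X_m satisfies γ(t) ∈ Ω for all t ∈ ℝ. -/
open Real Filter Set

noncomputable section

/-- A (global) solution of Bacciotti's system. -/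
def IsSolution (m : ℝ) (γ : ℝ → ℝ × ℝ) : Prop :=
  ∀ t : ℝ, HasDerivAt γ (bacciotti m (γ t)) t

/-- A periodic orbit: a nonconstant `T`-periodic solution with `T > 0`. -/
def IsPeriodicOrbit (m : ℝ) (γ : ℝ → ℝ × ℝ) (T : ℝ) : Prop :=
  IsSolution m γ ∧ (¬ ∃ c : ℝ × ℝ, ∀ t, γ t = c) ∧ 0 < T ∧ Function.Periodic γ T

/-- The saddle point `p_m^+ = (m^{−1/4}, m^{−1/4})`. -/
def pPlus (m : ℝ) : ℝ × ℝ := (m ^ (-(1 : ℝ) / 4), m ^ (-(1 : ℝ) / 4))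

/-- The saddle point `p_m^− = (−m^{−1/4}, −m^{−1/4})`. -/
def pMinus (m : ℝ) : ℝ × ℝ := (-(m ^ (-(1 : ℝ) / 4)), -(m ^ (-(1 : ℝ) / 4)))

/-- A heteroclinic connection from `p_m^−` to `p_m^+`. -/
def IsHeteroclinic (m : ℝ) (γ : ℝ → ℝ × ℝ) : Prop :=
  IsSolution m γ ∧ Tendsto γ atBot (nhds (pMinus m)) ∧ Tendsto γ atTop (nhds (pPlus m))

/-- The divergence of Bacciotti's system: `div X_m(x,y) = −3x² + 5m·y⁴`. -/
def divBacciotti (m : ℝ) (p : ℝ × ℝ) : ℝ :=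
  -3 * p.1 ^ 2 + 5 * m * p.2 ^ 4

/-- `T` is the minimal period of `γ`. -/
def IsMinimalPeriod (γ : ℝ → ℝ × ℝ) (T : ℝ) : Prop :=
  0 < T ∧ Function.Periodic γ T ∧ ∀ T' : ℝ, 0 < T' → Function.Periodic γ T' → T ≤ T'

/-- A continuous periodic real function attains its maximum. -/
theorem exists_forall_le_of_periodic {f : ℝ → ℝ} {T : ℝ} (hf : Continuous f) (hT : 0 < T)
    (hp : Function.Periodic f T) : ∃ s, ∀ t, f t ≤ f s := by
  obtain ⟨_, ⟨s, rfl⟩, hs⟩ :=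
    (hp.compact_of_continuous hT.ne' hf).exists_isGreatest (range_nonempty f)
  exact ⟨s, fun t => hs (mem_range_self t)⟩

/-- The second derivative is nonpositive at a global maximum. -/
theorem second_deriv_nonpos_of_forall_le {f f' : ℝ → ℝ} {f'' s : ℝ}
    (hf : ∀ t, HasDerivAt f (f' t) t) (hf' : HasDerivAt f' f'' s) (hs : ∀ t, f t ≤ f s) :
    f'' ≤ 0 := by
  by_contra! hpos
  have hderiv : deriv f = f' := funext fun t => (hf t).deriv
  have hmax : IsLocalMax f s := Eventually.of_forall hs
  have hmin : IsLocalMin f s := isLocalMin_of_deriv_deriv_pos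
    (by rw [hderiv, hf'.deriv]; exact hpos) hmax.deriv_eq_zero (hf s).continuousAt
  have hconst : f =ᶠ[nhds s] fun _ => f s := by
    filter_upwards [hmin] with t ht using le_antisymm (hs t) ht
  have hzero : f'' = 0 := by
    have h := hconst.deriv.deriv_eq
    rw [hderiv, hf'.deriv] at h
    simpa using h
  exact hpos.ne' hzero

/-- A periodic function that crosses the level `c` only upwards and reaches it somewhere stays
strictly above `c`. -/
theorem lt_of_periodic_of_deriv_pos {g g' : ℝ → ℝ} {T c s : ℝ} (hT : 0 < T)
    (hp : Function.Periodic g T) (hg : ∀ t, HasDerivAt g (g' t) t)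
    (hcross : ∀ t, g t = c → 0 < g' t) (hs : c ≤ g s) (t : ℝ) : c < g t := by
  have hle : ∀ t, c ≤ g t := by
    intro t
    obtain ⟨u, hu, hut⟩ := hp.exists_mem_Ico hT t s
    rw [hut]
    exact image_le_of_deriv_right_lt_deriv_boundary (f := fun _ => c) (f' := fun _ => 0)
      (a := s) (b := s + T) continuousOn_const
      (fun x _ => hasDerivWithinAt_const _ _ _) hs hg
      (fun x _ hx => hcross x hx.symm) (Ico_subset_Icc_self hu)
  refine lt_of_le_of_ne (hle t) fun heq => ?_
  have hmin : IsLocalMin g t := Eventually.of_forall fun u => heq ▸ hle u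
  exact (hcross t heq.symm).ne' (hmin.hasDerivAt_eq_zero (hg t))

theorem contDiff_bacciotti (m : ℝ) : ContDiff ℝ 1 (bacciotti m) := by
  unfold bacciotti
  fun_prop

theorem bacciotti_neg (m : ℝ) (p : ℝ × ℝ) : bacciotti m (-p) = -bacciotti m p := by
  ext <;> simp only [bacciotti, Prod.fst_neg, Prod.snd_neg] <;> ring

namespace IsSolution

variable {m : ℝ} {γ : ℝ → ℝ × ℝ}

theorem continuous (h : IsSolution m γ) : Continuous γ :=
  continuous_iff_continuousAt.2 fun t => (h t).continuousAt

theorem hasDerivAt_fst (h : IsSolution m γ) (t : ℝ) :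
    HasDerivAt (fun t => (γ t).1) ((γ t).2 ^ 3 - (γ t).1 ^ 3) t :=
  (hasFDerivAt_fst (𝕜 := ℝ) (p := γ t)).comp_hasDerivAt t (h t)

theorem hasDerivAt_snd (h : IsSolution m γ) (t : ℝ) :
    HasDerivAt (fun t => (γ t).2) (-(γ t).1 + m * (γ t).2 ^ 5) t :=
  (hasFDerivAt_snd (𝕜 := ℝ) (p := γ t)).comp_hasDerivAt t (h t)

end IsSolution

namespace IsPeriodicOrbit

variable {m : ℝ} {γ : ℝ → ℝ × ℝ} {T : ℝ}

theorem neg (h : IsPeriodicOrbit m γ T) : IsPeriodicOrbit m (-γ) T := by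
  obtain ⟨hsol, hne, hT, hp⟩ := h
  refine ⟨fun t => ?_, fun ⟨c, hc⟩ => hne ⟨-c, fun t => ?_⟩, hT, fun t => ?_⟩
  · rw [Pi.neg_apply, bacciotti_neg]
    exact (hsol t).neg
  · rw [← hc t, Pi.neg_apply, neg_neg]
  · rw [Pi.neg_apply, Pi.neg_apply, hp t]

/-- A periodic orbit contains no equilibrium. -/
theorem bacciotti_ne_zero (h : IsPeriodicOrbit m γ T) (t : ℝ) : bacciotti m (γ t) ≠ 0 := by
  obtain ⟨hsol, hne, hT, hp⟩ := h
  intro h0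
  obtain ⟨K, hK⟩ := LocallyLipschitzOn.exists_lipschitzOnWith_of_compact
    (hp.compact_of_continuous hT.ne' hsol.continuous)
    (contDiff_bacciotti m).locallyLipschitz.locallyLipschitzOn
  have heq : γ = fun _ => γ t := ODE_solution_unique_univ
    (v := fun _ => bacciotti m) (s := fun _ => range γ) (t₀ := t) (fun _ => hK)
    (fun u => ⟨hsol u, mem_range_self u⟩)
    (fun u => ⟨by rw [h0]; exact hasDerivAt_const _ _, mem_range_self t⟩) rfl
  exact hne ⟨γ t, fun u => congrFun heq u⟩

/-- A periodic orbit meets the diagonal at a point where its first coordinate is maximal. -/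
theorem exists_fst_max (h : IsPeriodicOrbit m γ T) :
    ∃ s, (∀ t, (γ t).1 ≤ (γ s).1) ∧ (γ s).2 = (γ s).1 := by
  obtain ⟨hsol, -, hT, hp⟩ := h
  obtain ⟨s, hs⟩ := exists_forall_le_of_periodic (f := fun t => (γ t).1)
    (continuous_fst.comp hsol.continuous) hT (hp.comp Prod.fst)
  have hmax : IsLocalMax (fun t => (γ t).1) s := Eventually.of_forall hs
  have h0 := hmax.hasDerivAt_eq_zero (hsol.hasDerivAt_fst s)
  exact ⟨s, hs, (Odd.strictMono_pow (by decide : Odd 3)).injective (sub_eq_zero.1 h0)⟩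

theorem fst_lt (h : IsPeriodicOrbit m γ T) {a : ℝ} (ha : 0 < a) (hma : m * a ^ 4 = 1) (t : ℝ) :
    (γ t).1 < a := by
  obtain ⟨s, hs, hdiag⟩ := h.exists_fst_max
  have hm : 0 < m := pos_of_mul_pos_left (hma ▸ one_pos) (by positivity)
  refine (hs t).trans_lt ?_
  by_contra! hle
  have hx := h.1.hasDerivAt_fst
  have hy := h.1.hasDerivAt_snd
  have h2 := second_deriv_nonpos_of_forall_le hx (((hy s).pow 3).sub ((hx s).pow 3)) hs
  have h0 := h.bacciotti_ne_zero s
  rw [hdiag] at h2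
  have hx0 : 0 < (γ s).1 := ha.trans_le hle
  have h3 : (γ s).1 ^ 3 * (m * (γ s).1 ^ 4 - 1) ≤ 0 := by
    norm_num at h2
    nlinarith
  have h4 : m * (γ s).1 ^ 4 ≤ 1 := by
    have := nonpos_of_mul_nonpos_right h3 (by positivity)
    linarith
  have h5 : (γ s).1 ^ 4 ≤ a ^ 4 := le_of_mul_le_mul_left (by linarith) hm
  have h6 : (γ s).1 = a := le_antisymm (le_of_pow_le_pow_left₀ (by norm_num) ha.le h5) hle
  apply h0
  ext
  · simp [bacciotti, hdiag]
  · simp only [bacciotti, hdiag, h6, Prod.snd_zero]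
    linear_combination a * hma

theorem abs_fst_lt (h : IsPeriodicOrbit m γ T) {a : ℝ} (ha : 0 < a) (hma : m * a ^ 4 = 1)
    (t : ℝ) : |(γ t).1| < a :=
  abs_lt.2 ⟨neg_lt.1 (h.neg.fst_lt ha hma t), h.fst_lt ha hma t⟩

theorem snd_lt (h : IsPeriodicOrbit m γ T) {a : ℝ} (ha : 0 < a) (hma : m * a ^ 4 = 1) (t : ℝ) :
    (γ t).2 < a := by
  have hm : 0 < m := pos_of_mul_pos_left (hma ▸ one_pos) (by positivity)
  obtain ⟨s, hs⟩ := exists_forall_le_of_periodic (f := fun t => (γ t).2)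
    (continuous_snd.comp h.1.continuous) h.2.2.1 (h.2.2.2.comp Prod.snd)
  have hmax : IsLocalMax (fun t => (γ t).2) s := Eventually.of_forall hs
  have h0 := hmax.hasDerivAt_eq_zero (h.1.hasDerivAt_snd s)
  refine (hs t).trans_lt ?_
  by_contra! hle
  have h5 : m * a ^ 5 ≤ m * (γ s).2 ^ 5 := by gcongr
  have hx := h.fst_lt ha hma s
  have : m * a ^ 5 = a := by linear_combination a * hma
  linarith

theorem abs_snd_lt (h : IsPeriodicOrbit m γ T) {a : ℝ} (ha : 0 < a) (hma : m * a ^ 4 = 1)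
    (t : ℝ) : |(γ t).2| < a :=
  abs_lt.2 ⟨neg_lt.1 (h.neg.snd_lt ha hma t), h.snd_lt ha hma t⟩

/-- For `m < 1` the flow crosses the hyperbola `x * y = -1` only in the direction of increasing
`x * y`, so a periodic orbit cannot reach it. -/
theorem neg_one_lt_mul (h : IsPeriodicOrbit m γ T) (hm : m < 1) (t : ℝ) :
    -1 < (γ t).1 * (γ t).2 := by
  obtain ⟨s, -, hdiag⟩ := h.exists_fst_max
  refine lt_of_periodic_of_deriv_pos (g := fun t => (γ t).1 * (γ t).2) (s := s) h.2.2.1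
    (h.2.2.2.comp fun p => p.1 * p.2)
    (fun t => (h.1.hasDerivAt_fst t).mul (h.1.hasDerivAt_snd t)) (fun t ht => ?_) ?_ t
  · have hy : (γ t).2 ≠ 0 := fun h0 => by simp [h0] at ht
    have hpos : 0 < (1 - m) * (γ t).2 ^ 4 := mul_pos (sub_pos.2 hm) (by positivity)
    refine hpos.trans_eq ?_
    linear_combination ((γ t).1 ^ 2 - m * (γ t).2 ^ 4) * ht
  · rw [hdiag]
    nlinarith [sq_nonneg (γ s).1]

end IsPeriodicOrbit

theorem periodic_orbits_in_Omega (m : ℝ) (hm : 0 < m)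
    (γ : ℝ → ℝ × ℝ) (T : ℝ) (hγ : IsPeriodicOrbit m γ T) :
    ∀ t : ℝ, |(γ t).1| < m ^ (-(1 : ℝ) / 4) ∧ |(γ t).2| < m ^ (-(1 : ℝ) / 4) ∧
      -1 < (γ t).1 * (γ t).2 := by
  intro t
  have ha : 0 < m ^ (-(1 : ℝ) / 4) := rpow_pos_of_pos hm _
  have hma : m * (m ^ (-(1 : ℝ) / 4)) ^ 4 = 1 := by
    rw [← rpow_natCast, ← rpow_mul hm.le]
    norm_num [rpow_neg_one, hm.ne']
  have hx := hγ.abs_fst_lt ha hma t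
  have hy := hγ.abs_snd_lt ha hma t
  refine ⟨hx, hy, ?_⟩
  rcases lt_or_ge m 1 with hm1 | hm1
  · exact hγ.neg_one_lt_mul hm1 t
  · have ha1 : m ^ (-(1 : ℝ) / 4) ≤ 1 := rpow_le_one_of_one_le_of_nonpos hm1 (by norm_num)
    have hxy : |(γ t).1 * (γ t).2| < 1 := by
      rw [abs_mul]
      exact mul_lt_one_of_nonneg_of_lt_one_left (abs_nonneg _) (hx.trans_le ha1)
        (hy.le.trans ha1)
    exact (abs_lt.1 hxy).1

end
end

section
/- For every m ∈ (0, 9/25], Bacciotti's system X_m has no periodic orbit and no heteroclinic connection. -/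
open Real Filter Set

noncomputable section

namespace Bacciotti

/-- The base of the Dulac multiplier `(1 + (3b/5)xy)⁻⁵`, where `m = b²`. -/
def dulacBase (b x y : ℝ) : ℝ := 1 + 3 / 5 * b * x * y

/-- A primitive in `y` of `(y³ − x³)(1 + (3b/5)xy)⁻⁵`. -/
def fluxPrimitive (b x y : ℝ) : ℝ :=
  (y ^ 4 - x ^ 3 * y * (1 + dulacBase b x y + dulacBase b x y ^ 2 + dulacBase b x y ^ 3)) /
    (4 * dulacBase b x y ^ 4)

/-- The partial derivative of `fluxPrimitive` in `x`. -/
def fluxPrimitiveDx (b x y : ℝ) : ℝ :=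
  (-3 * x ^ 2 * y * (1 + dulacBase b x y + dulacBase b x y ^ 2 + dulacBase b x y ^ 3) -
      x ^ 3 * y * (3 / 5 * b * y) * (1 + 2 * dulacBase b x y + 3 * dulacBase b x y ^ 2)) /
    (4 * dulacBase b x y ^ 4) -
  (y ^ 4 - x ^ 3 * y * (1 + dulacBase b x y + dulacBase b x y ^ 2 + dulacBase b x y ^ 3)) *
    (3 / 5 * b * y) / dulacBase b x y ^ 5

/-- The sum of `∂ₓ fluxPrimitive` and the second component of the rescaled vector field; its
`y`-derivative is the divergence of the rescaled field. -/
def fluxSlope (b x y : ℝ) : ℝ :=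
  fluxPrimitiveDx b x y + (-x + b ^ 2 * y ^ 5) / dulacBase b x y ^ 5

/-- A Lyapunov function for Bacciotti's system in the square `b·max(|x|,|y|)² ≤ 1`. -/
def lyapunov (b : ℝ) (p : ℝ × ℝ) : ℝ :=
  fluxPrimitive b p.1 p.2 - ∫ s in (0 : ℝ)..p.1, fluxSlope b s s

/-- The divergence of the rescaled field, multiplied by the sixth power of `dulacBase`. -/
def dulacDivergence (b x y : ℝ) : ℝ :=
  b * (5 * b - 3) * y ^ 4 + x ^ 2 * (-3 + 3 * b + 6 / 5 * b * x * y)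

variable {b m r x y : ℝ}

lemma hasDerivAt_fluxPrimitive {u v : ℝ → ℝ} {u' v' t : ℝ} (hu : HasDerivAt u u' t)
    (hv : HasDerivAt v v' t) (hg : dulacBase b (u t) (v t) ≠ 0) :
    HasDerivAt (fun s => fluxPrimitive b (u s) (v s))
      (fluxPrimitiveDx b (u t) (v t) * u' +
        (v t ^ 3 - u t ^ 3) / dulacBase b (u t) (v t) ^ 5 * v') t := by
  have hG : HasDerivAt (fun s => dulacBase b (u s) (v s))
      (3 / 5 * b * (u' * v t + u t * v')) t := by
    have := ((hu.mul hv).const_mul (3 / 5 * b)).const_add 1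
    refine this.congr_of_eventuallyEq (Eventually.of_forall fun s => ?_)
    simp [dulacBase]; ring
  have hS := ((hG.const_add 1).add (hG.pow 2)).add (hG.pow 3)
  have hN := (hv.pow 4).sub (((hu.pow 3).mul hv).mul hS)
  have hD := (hG.pow 4).const_mul 4
  have h := hN.div hD (mul_ne_zero four_ne_zero (pow_ne_zero 4 hg))
  refine HasDerivAt.congr_deriv (f := fun s => fluxPrimitive b (u s) (v s)) h ?_
  simp only [fluxPrimitiveDx, Pi.add_apply, Pi.mul_apply, Pi.pow_apply, Pi.sub_apply]
  have hv' : 3 / 5 * b * u t * v t = dulacBase b (u t) (v t) - 1 := by simp [dulacBase]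
  generalize dulacBase b (u t) (v t) = g at *
  field_simp
  push_cast
  linear_combination (v' * (5 / 3) * (u t ^ 3 * (12 * g ^ 3 + 9 * g ^ 4 + 6 * g ^ 5 + 3 * g ^ 6) -
    12 * g ^ 3 * v t ^ 3)) * hv'

lemma hasDerivAt_fluxSlope (hg : dulacBase b x y ≠ 0) :
    HasDerivAt (fluxSlope b x) (dulacDivergence b x y / dulacBase b x y ^ 6) y := by
  have hy := hasDerivAt_id y
  have hG : HasDerivAt (dulacBase b x) (3 / 5 * b * x) y := by
    have := (hy.const_mul (3 / 5 * b * x)).const_add 1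
    rwa [mul_one] at this
  have hS := ((hG.const_add 1).add (hG.pow 2)).add (hG.pow 3)
  have hS' := ((hG.const_mul 2).const_add 1).add ((hG.pow 2).const_mul 3)
  have h₁ := (((hy.const_mul (-3 * x ^ 2)).mul hS).sub
    (((hy.const_mul (x ^ 3)).mul (hy.const_mul (3 / 5 * b))).mul hS')).div
    ((hG.pow 4).const_mul 4) (mul_ne_zero four_ne_zero (pow_ne_zero 4 hg))
  have h₂ := (((hy.pow 4).sub ((hy.const_mul (x ^ 3)).mul hS)).mul
    (hy.const_mul (3 / 5 * b))).div (hG.pow 5) (pow_ne_zero 5 hg)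
  have h₃ := (((hy.pow 5).const_mul (b ^ 2)).const_add (-x)).div (hG.pow 5) (pow_ne_zero 5 hg)
  refine HasDerivAt.congr_deriv (f := fluxSlope b x) ((h₁.sub h₂).add h₃) ?_
  simp only [dulacDivergence, Pi.add_apply, Pi.sub_apply, Pi.mul_apply, Pi.pow_apply, id_eq]
  have hv' : 3 / 5 * b * x * y = dulacBase b x y - 1 := by simp [dulacBase]
  generalize dulacBase b x y = g at *
  field_simp
  obtain rfl : g = 1 + 3 / 5 * b * x * y := by linarith
  push_cast
  ring

lemma dulacBase_pos (hb₀ : 0 < b) (hbr : b * r ^ 2 ≤ 1) (hx : |x| ≤ r) (hy : |y| ≤ r) :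
    0 < dulacBase b x y := by
  have h : |x * y| ≤ r ^ 2 := by
    rw [abs_mul, sq]
    exact mul_le_mul hx hy (abs_nonneg _) ((abs_nonneg x).trans hx)
  have := mul_le_mul_of_nonneg_left (abs_le.1 h).1 hb₀.le
  unfold dulacBase
  linarith

lemma fluxSlope_strictAntiOn (hb₀ : 0 < b) (hb : b ≤ 3 / 5) (hbr : b * r ^ 2 ≤ 1)
    (hx : |x| ≤ r) (hx₀ : x ≠ 0) : StrictAntiOn (fluxSlope b x) (Icc (-r) r) := by
  have hg : ∀ y ∈ Icc (-r) r, 0 < dulacBase b x y := fun y hy =>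
    dulacBase_pos hb₀ hbr hx (abs_le.2 hy)
  refine strictAntiOn_of_deriv_neg (convex_Icc _ _)
    (fun y hy => (hasDerivAt_fluxSlope (hg y hy).ne').continuousAt.continuousWithinAt)
    fun y hy => ?_
  have hys := interior_subset hy
  rw [interior_Icc, mem_Ioo, ← abs_lt] at hy
  rw [(hasDerivAt_fluxSlope (hg y hys).ne').deriv]
  refine div_neg_of_neg_of_pos ?_ (pow_pos (hg y hys) 6)
  have hr : 0 < r := (abs_nonneg y).trans_lt hy
  have hlt : b * x * y < 1 := calc
    b * x * y ≤ b * (|x| * |y|) := by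
      rw [mul_assoc, ← abs_mul]; exact mul_le_mul_of_nonneg_left (le_abs_self _) hb₀.le
    _ < b * (r * r) := by
      refine mul_lt_mul_of_pos_left ?_ hb₀
      exact mul_lt_mul' hx hy (abs_nonneg y) hr
    _ ≤ 1 := by rwa [← sq]
  have h₁ : b * (5 * b - 3) * y ^ 4 ≤ 0 :=
    mul_nonpos_of_nonpos_of_nonneg (mul_nonpos_of_nonneg_of_nonpos hb₀.le (by linarith))
      (by positivity)
  have h₂ : x ^ 2 * (-3 + 3 * b + 6 / 5 * b * x * y) < 0 :=
    mul_neg_of_pos_of_neg (by positivity) (by linarith)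
  unfold dulacDivergence
  linarith

lemma continuous_fluxSlope_diag (hb₀ : 0 < b) : Continuous fun s => fluxSlope b s s := by
  have hg : ∀ s, dulacBase b s s ≠ 0 := fun s => by
    have : 0 ≤ 3 / 5 * b * s * s := by
      rw [mul_assoc]; exact mul_nonneg (by positivity) (mul_self_nonneg s)
    unfold dulacBase; positivity
  have hc : Continuous fun s => dulacBase b s s := by unfold dulacBase; fun_prop
  unfold fluxSlope fluxPrimitiveDx
  fun_prop (disch := simp [hg])

lemma fluxSlope_neg (b x y : ℝ) : fluxSlope b (-x) (-y) = -fluxSlope b x y := by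
  have : dulacBase b (-x) (-y) = dulacBase b x y := by simp [dulacBase]
  simp only [fluxSlope, fluxPrimitiveDx, this]
  ring

lemma lyapunov_neg (b : ℝ) (p : ℝ × ℝ) : lyapunov b (-p) = lyapunov b p := by
  have h₁ : fluxPrimitive b (-p.1) (-p.2) = fluxPrimitive b p.1 p.2 := by
    have : dulacBase b (-p.1) (-p.2) = dulacBase b p.1 p.2 := by simp [dulacBase]
    simp only [fluxPrimitive, this]
    ring
  have h₂ : ∫ s in (0 : ℝ)..-p.1, fluxSlope b s s = ∫ s in (0 : ℝ)..p.1, fluxSlope b s s := by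
    have := intervalIntegral.integral_comp_neg (a := 0) (b := p.1) fun s => fluxSlope b s s
    simp only [fluxSlope_neg, intervalIntegral.integral_neg, neg_zero] at this
    rw [intervalIntegral.integral_symm, ← this, neg_neg]
  simp [lyapunov, h₁, h₂]

lemma hasDerivAt_lyapunov (hb₀ : 0 < b) {γ : ℝ → ℝ × ℝ} (hγ : IsSolution (b ^ 2) γ) {t : ℝ}
    (hg : dulacBase b (γ t).1 (γ t).2 ≠ 0) :
    HasDerivAt (fun s => lyapunov b (γ s)) (((γ t).2 ^ 3 - (γ t).1 ^ 3) *
      (fluxSlope b (γ t).1 (γ t).2 - fluxSlope b (γ t).1 (γ t).1)) t := by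
  have hu : HasDerivAt (fun s => (γ s).1) _ t := (hγ t).fst
  have hv : HasDerivAt (fun s => (γ s).2) _ t := (hγ t).snd
  have hN := (continuous_fluxSlope_diag hb₀).integral_hasStrictDerivAt 0 (γ t).1
  refine ((hasDerivAt_fluxPrimitive hu hv hg).sub (hN.hasDerivAt.comp t hu)).congr_deriv ?_
  simp only [bacciotti, fluxSlope]
  ring

lemma continuousAt_lyapunov (hb₀ : 0 < b) {p : ℝ × ℝ} (hg : dulacBase b p.1 p.2 ≠ 0) :
    ContinuousAt (lyapunov b) p := by
  have hN : Continuous fun x => ∫ s in (0 : ℝ)..x, fluxSlope b s s :=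
    intervalIntegral.continuous_primitive
      (fun _ _ => (continuous_fluxSlope_diag hb₀).intervalIntegrable _ _) 0
  have hc : ContinuousAt (fun p : ℝ × ℝ => dulacBase b p.1 p.2) p := by
    unfold dulacBase; fun_prop
  refine ContinuousAt.sub ?_ (hN.comp continuous_fst).continuousAt
  unfold fluxPrimitive
  fun_prop (disch := simp [hg])

/-- On the square `max(|x|,|y|) ≤ r` with `b r² ≤ 1`, the function `lyapunov b` decreases along
solutions, strictly so away from the lines `x = 0` and `x = y`. -/
lemma lyapunov_deriv_neg (hb₀ : 0 < b) (hb : b ≤ 3 / 5) (hbr : b * r ^ 2 ≤ 1) (hx : |x| ≤ r)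
    (hy : |y| ≤ r) (hx₀ : x ≠ 0) (hxy : x ≠ y) :
    (y ^ 3 - x ^ 3) * (fluxSlope b x y - fluxSlope b x x) < 0 := by
  have hanti := fluxSlope_strictAntiOn hb₀ hb hbr hx hx₀
  have hcube : StrictMono fun z : ℝ => z ^ 3 := Odd.strictMono_pow (by decide)
  rcases lt_or_gt_of_ne hxy with h | h
  · exact mul_neg_of_pos_of_neg (sub_pos.2 (hcube h))
      (sub_neg.2 (hanti (abs_le.1 hx) (abs_le.1 hy) h))
  · exact mul_neg_of_neg_of_pos (sub_neg.2 (hcube h))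
      (sub_pos.2 (hanti (abs_le.1 hy) (abs_le.1 hx) h))

lemma fst_snd_le_of_solution (hr : 0 < r) (hmr : m * r ^ 4 = 1) {γ : ℝ → ℝ × ℝ}
    (hγ : IsSolution m γ)
    (hmax₁ : (∃ t, r < (γ t).1) → ∃ t, ∀ s, (γ s).1 ≤ (γ t).1)
    (hmax₂ : (∃ t, r < (γ t).2) → ∃ t, ∀ s, (γ s).2 ≤ (γ t).2) (t : ℝ) :
    (γ t).1 ≤ r ∧ (γ t).2 ≤ r := by
  have hm : 0 < m := pos_of_mul_pos_left (hmr ▸ one_pos) (by positivity)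
  have hd₁ : ∀ s, HasDerivAt (fun s => (γ s).1) ((γ s).2 ^ 3 - (γ s).1 ^ 3) s :=
    fun s => (hγ s).fst
  have hd₂ : ∀ s, HasDerivAt (fun s => (γ s).2) (-(γ s).1 + m * (γ s).2 ^ 5) s :=
    fun s => (hγ s).snd
  have h₁ : ∀ s, (γ s).1 ≤ r := by
    by_contra! h
    obtain ⟨s, hs⟩ := hmax₁ h
    have hsr : r < (γ s).1 := h.elim fun u hu => hu.trans_le (hs u)
    have hds := IsLocalMax.hasDerivAt_eq_zero (Eventually.of_forall hs) (hd₁ s)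
    have heq : (γ s).2 = (γ s).1 :=
      (Odd.strictMono_pow (n := 3) (by decide)).injective (sub_eq_zero.1 hds)
    obtain ⟨u, hu⟩ := hmax₂ ⟨s, heq ▸ hsr⟩
    have hdu := IsLocalMax.hasDerivAt_eq_zero (Eventually.of_forall hu) (hd₂ u)
    have hur : r < (γ u).2 := (heq ▸ hsr).trans_le (hu s)
    have hpow : r ^ 4 < (γ u).2 ^ 4 := by gcongr
    nlinarith [hs u, hu s, mul_pos (mul_pos hm (hr.trans hur)) (sub_pos.2 hpow)]
  refine ⟨h₁ t, ?_⟩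
  by_contra! h
  obtain ⟨u, hu⟩ := hmax₂ ⟨t, h⟩
  have hdu := IsLocalMax.hasDerivAt_eq_zero (Eventually.of_forall hu) (hd₂ u)
  have hur : r < (γ u).2 := h.trans_le (hu t)
  have hpow : r ^ 4 < (γ u).2 ^ 4 := by gcongr
  nlinarith [h₁ u, mul_pos (mul_pos hm (hr.trans hur)) (sub_pos.2 hpow)]

lemma isSolution_neg {γ : ℝ → ℝ × ℝ} (hγ : IsSolution m γ) : IsSolution m (-γ) := fun t => by
  refine (hγ t).neg.congr_deriv ?_
  ext <;> simp [bacciotti] <;> ring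

lemma abs_le_of_solution (hr : 0 < r) (hmr : m * r ^ 4 = 1) {γ : ℝ → ℝ × ℝ}
    (hγ : IsSolution m γ)
    (hmax : ∀ f : ℝ × ℝ → ℝ, Continuous f → f (r, r) ≤ r → f (-r, -r) ≤ r →
      (∃ t, r < f (γ t)) → ∃ t, ∀ s, f (γ s) ≤ f (γ t)) (t : ℝ) :
    |(γ t).1| ≤ r ∧ |(γ t).2| ≤ r := by
  have hr' : -r ≤ r := by linarith
  obtain ⟨h₁, h₂⟩ := fst_snd_le_of_solution hr hmr hγ
    (hmax Prod.fst continuous_fst le_rfl hr') (hmax Prod.snd continuous_snd le_rfl hr') t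
  obtain ⟨h₃, h₄⟩ := fst_snd_le_of_solution hr hmr (isSolution_neg hγ)
    (hmax (fun p => -p.1) (by fun_prop) hr' (neg_neg r).le)
    (hmax (fun p => -p.2) (by fun_prop) hr' (neg_neg r).le) t
  simp only [Pi.neg_apply, Prod.fst_neg, Prod.snd_neg] at h₃ h₄
  exact ⟨abs_le.2 ⟨by linarith, h₁⟩, abs_le.2 ⟨by linarith, h₂⟩⟩

lemma lyapunov_antitone (hb₀ : 0 < b) (hb : b ≤ 3 / 5) (hbr : b * r ^ 2 ≤ 1) {γ : ℝ → ℝ × ℝ}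
    (hγ : IsSolution (b ^ 2) γ) (hsq : ∀ t, |(γ t).1| ≤ r ∧ |(γ t).2| ≤ r) :
    Antitone fun t => lyapunov b (γ t) := by
  have hd := fun t => hasDerivAt_lyapunov hb₀ hγ
    (dulacBase_pos hb₀ hbr (hsq t).1 (hsq t).2).ne'
  refine antitone_of_deriv_nonpos (fun t => (hd t).differentiableAt) fun t => ?_
  rw [(hd t).deriv]
  by_cases hxy : (γ t).1 = (γ t).2
  · simp [hxy]
  by_cases hx₀ : (γ t).1 = 0
  · have h : fluxSlope b 0 (γ t).2 - fluxSlope b 0 0 = b * (b - 3 / 5) * (γ t).2 ^ 5 := by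
      simp [fluxSlope, fluxPrimitiveDx, dulacBase]
      ring
    rw [hx₀, h]
    nlinarith [mul_nonneg (mul_nonneg hb₀.le (sub_nonneg.2 hb)) (pow_nonneg (sq_nonneg (γ t).2) 4)]
  · exact (lyapunov_deriv_neg hb₀ hb hbr (hsq t).1 (hsq t).2 hx₀ hxy).le

lemma solution_constant_of_lyapunov_constant (hb₀ : 0 < b) (hb : b ≤ 3 / 5)
    (hbr : b * r ^ 2 ≤ 1) {γ : ℝ → ℝ × ℝ} (hγ : IsSolution (b ^ 2) γ)
    (hsq : ∀ t, |(γ t).1| ≤ r ∧ |(γ t).2| ≤ r)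
    (hconst : ∀ s t, lyapunov b (γ s) = lyapunov b (γ t)) :
    ∃ c, ∀ t, γ t = c := by
  have hd₁ : ∀ s, HasDerivAt (fun s => (γ s).1) ((γ s).2 ^ 3 - (γ s).1 ^ 3) s :=
    fun s => (hγ s).fst
  have hline : ∀ t, (γ t).1 = 0 ∨ (γ t).1 = (γ t).2 := fun t => by
    by_contra! h
    have hW := hasDerivAt_lyapunov hb₀ hγ (dulacBase_pos hb₀ hbr (hsq t).1 (hsq t).2).ne'
    have hW₀ : HasDerivAt (fun s => lyapunov b (γ s)) 0 t := by
      simpa only [hconst _ t] using hasDerivAt_const t (lyapunov b (γ t))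
    exact (lyapunov_deriv_neg hb₀ hb hbr (hsq t).1 (hsq t).2 h.1 h.2).ne (hW.unique hW₀)
  have hdiag : ∀ t, (γ t).1 = (γ t).2 := fun t => by
    by_contra hne
    have hx : (γ t).1 = 0 := (hline t).resolve_right hne
    have hcont : ContinuousAt γ t := (hγ t).continuousAt
    have hev : ∀ᶠ s in nhds t, (γ s).1 = 0 := by
      filter_upwards [(hcont.fst.sub hcont.snd).eventually_ne (sub_ne_zero.2 hne)] with s hs
        using (hline s).resolve_right (sub_ne_zero.1 hs)
    have := (hd₁ t).unique ((hasDerivAt_const t (0 : ℝ)).congr_of_eventuallyEq hev)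
    exact hne ((Odd.strictMono_pow (n := 3) (by decide)).injective (sub_eq_zero.1 this)).symm
  refine ⟨γ 0, fun t => ?_⟩
  have hfst : (γ t).1 = (γ 0).1 := is_const_of_deriv_eq_zero
    (fun s => (hd₁ s).differentiableAt) (fun s => by rw [(hd₁ s).deriv, hdiag s, sub_self]) t 0
  exact Prod.ext hfst (by rw [← hdiag t, ← hdiag 0, hfst])

end Bacciotti

open Bacciotti

theorem bacciotti_no_cycles_small_m (m : ℝ) (hm₁ : 0 < m) (hm₂ : m ≤ 9 / 25) :
    (¬ ∃ (γ : ℝ → ℝ × ℝ) (T : ℝ), IsPeriodicOrbit m γ T) ∧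
    (¬ ∃ γ : ℝ → ℝ × ℝ, IsHeteroclinic m γ) := by
  obtain ⟨b, hb₀, rfl⟩ : ∃ b, 0 < b ∧ m = b ^ 2 :=
    ⟨√m, by positivity, (Real.sq_sqrt hm₁.le).symm⟩
  have hb : b ≤ 3 / 5 := by nlinarith
  obtain ⟨r, hr, hbr, hpP⟩ : ∃ r : ℝ, 0 < r ∧ b * r ^ 2 = 1 ∧ pPlus (b ^ 2) = (r, r) := by
    refine ⟨(b ^ 2) ^ (-(1 : ℝ) / 4), by positivity, ?_, rfl⟩
    rw [← Real.rpow_natCast _ 2, ← Real.rpow_natCast b 2, ← Real.rpow_mul hb₀.le,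
      ← Real.rpow_mul hb₀.le]
    norm_num [Real.rpow_neg_one, hb₀.ne']
  have hpM : pMinus (b ^ 2) = -(r, r) := by rw [← hpP]; rfl
  have hmr : b ^ 2 * r ^ 4 = 1 := by linear_combination (b * r ^ 2 + 1) * hbr
  constructor
  · rintro ⟨γ, T, hγ, hnc, hT, hper⟩
    have hγc : Continuous γ := continuous_iff_continuousAt.2 fun t => (hγ t).continuousAt
    have hsq := abs_le_of_solution hr hmr hγ fun f hf _ _ _ => by
      obtain ⟨t, -, ht⟩ := isCompact_Icc.exists_isMaxOn (nonempty_Icc.2 hT.le)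
        (hf.comp hγc).continuousOn
      refine ⟨t, fun s => ?_⟩
      obtain ⟨u, hu, hsu⟩ := hper.exists_mem_Ico₀ hT s
      rw [hsu]
      exact ht (Ico_subset_Icc_self hu)
    have hanti := lyapunov_antitone hb₀ hb hbr.le hγ hsq
    have hle : ∀ s t, lyapunov b (γ s) ≤ lyapunov b (γ t) := fun s t => by
      obtain ⟨n, hn⟩ := exists_nat_ge ((t - s) / T)
      have := hanti (show t ≤ s + n * T by linarith [(div_le_iff₀ hT).1 hn])
      simpa only [hper.nat_mul n s] using this
    exact hnc (solution_constant_of_lyapunov_constant hb₀ hb hbr.le hγ hsq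
      fun s t => (hle s t).antisymm (hle t s))
  · rintro ⟨γ, hγ, hbot, htop⟩
    have hγc : Continuous γ := continuous_iff_continuousAt.2 fun t => (hγ t).continuousAt
    rw [hpM] at hbot
    rw [hpP] at htop
    have hsq := abs_le_of_solution hr hmr hγ fun f hf hfp hfm ⟨t₀, ht₀⟩ => by
      refine (hf.comp hγc).exists_forall_ge' t₀ ?_
      rw [cocompact_eq_atBot_atTop, eventually_sup]
      exact ⟨((hf.tendsto _).comp hbot).eventually_le_const (hfm.trans_lt ht₀),
        ((hf.tendsto _).comp htop).eventually_le_const (hfp.trans_lt ht₀)⟩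
    have hanti := lyapunov_antitone hb₀ hb hbr.le hγ hsq
    have hcont := continuousAt_lyapunov hb₀ (p := (r, r))
      (dulacBase_pos hb₀ hbr.le (abs_of_pos hr).le (abs_of_pos hr).le).ne'
    have hcont' := continuousAt_lyapunov hb₀ (p := -(r, r))
      (dulacBase_pos hb₀ hbr.le (by simp [abs_of_pos hr]) (by simp [abs_of_pos hr])).ne'
    have hge := hanti.le_of_tendsto (hcont.tendsto.comp htop)
    have hle := hanti.ge_of_tendsto (hcont'.tendsto.comp hbot)
    simp only [lyapunov_neg] at hle
    obtain ⟨c, hc⟩ := solution_constant_of_lyapunov_constant hb₀ hb hbr.le hγ hsq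
      fun s t => ((hle s).trans (hge t)).antisymm ((hle t).trans (hge s))
    have hγ_eq : γ = fun _ => c := funext hc
    rw [hγ_eq, tendsto_const_nhds_iff] at hbot htop
    have := congrArg Prod.fst (hbot.symm.trans htop)
    simp at this
    linarith

end
end

section
/- For every m ∈ [3/5, ∞), Bacciotti's system X_m has no periodic orbit and no heteroclinic connection. -/
open Real Filter Set

noncomputable section

theorem nonneg_of_even {f : ℝ → ℝ → ℝ} (hf : ∀ x y, f (-x) (-y) = f x y)
    (h : ∀ x y, |x| ≤ 1 → y ∈ Icc 0 1 → 0 ≤ f x y) {x y : ℝ} (hx : |x| ≤ 1) (hy : |y| ≤ 1) :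
    0 ≤ f x y := by
  obtain h0 | h0 := le_total 0 y
  · exact h x y hx ⟨h0, (le_abs_self y).trans hy⟩
  · rw [← hf]
    exact h _ _ (by rwa [abs_neg]) ⟨by linarith, (neg_le_abs y).trans hy⟩

theorem nonneg_of_even_of_cones {f : ℝ → ℝ → ℝ} (hf : ∀ x y, f (-x) (-y) = f x y)
    (h₁ : ∀ x y, |x| ≤ y → y ≤ 1 → 0 ≤ f x y) (h₂ : ∀ x y, |y| ≤ x → x ≤ 1 → 0 ≤ f x y)
    {x y : ℝ} (hx : |x| ≤ 1) (hy : |y| ≤ 1) : 0 ≤ f x y := by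
  obtain hxy | hxy := le_total |x| |y|
  · obtain h0 | h0 := abs_choice y <;> rw [h0] at hxy hy
    · exact h₁ x y hxy hy
    · rw [← hf]
      exact h₁ _ _ (by rwa [abs_neg]) hy
  · obtain h0 | h0 := abs_choice x <;> rw [h0] at hxy hx
    · exact h₂ x y hxy hx
    · rw [← hf]
      exact h₂ _ _ (by rwa [abs_neg]) hx

/-! ### Certifying nonnegativity of bivariate integer polynomials -/

/-- The homogeneous polynomial `∑ aᵢ xⁱ w^(n-1-i)` with coefficient list `a` of length `n`. -/
def homEval : List ℝ → ℝ → ℝ → ℝ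
  | [], _, _ => 0
  | a :: l, x, w => a * w ^ l.length + x * homEval l x w

/-- Coefficients of `a wⁿ + (x + w) s(x, w)`, where `s` has length `n`. -/
def shiftCons {α : Type*} (op : α → α → α) (a : α) : List α → List α
  | [] => [a]
  | b :: s => op a b :: shiftCons op b s

/-- Coefficients of the Taylor shift `l(x + w, w)`. -/
def taylorShift {α : Type*} (op : α → α → α) (l : List α) : List α :=
  l.foldr (shiftCons op) []

theorem length_shiftCons {α : Type*} (op : α → α → α) (a : α) (s : List α) :
    (shiftCons op a s).length = s.length + 1 := by
  induction s generalizing a with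
  | nil => rfl
  | cons b s ih => simp [shiftCons, ih]

theorem length_taylorShift {α : Type*} (op : α → α → α) (l : List α) :
    (taylorShift op l).length = l.length := by
  induction l with
  | nil => rfl
  | cons a l ih =>
    change (shiftCons op a (taylorShift op l)).length = _
    rw [length_shiftCons, ih, List.length_cons]

theorem homEval_shiftCons (a : ℝ) (s : List ℝ) (x w : ℝ) :
    homEval (shiftCons (· + ·) a s) x w = a * w ^ s.length + (x + w) * homEval s x w := by
  induction s generalizing a with
  | nil => simp [shiftCons, homEval]
  | cons b s ih =>
    simp only [shiftCons, homEval, ih, length_shiftCons, List.length_cons]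
    ring

theorem homEval_taylorShift (l : List ℝ) (x w : ℝ) :
    homEval (taylorShift (· + ·) l) x w = homEval l (x + w) w := by
  induction l with
  | nil => rfl
  | cons a l ih =>
    change homEval (shiftCons _ a (taylorShift _ l)) x w = _
    rw [homEval_shiftCons, ih, length_taylorShift, homEval]

theorem homEval_append_singleton (l : List ℝ) (a x w : ℝ) :
    homEval (l ++ [a]) x w = w * homEval l x w + a * x ^ l.length := by
  induction l with
  | nil => simp [homEval]
  | cons b l ih =>
    simp only [List.cons_append, homEval, ih, List.length_append, List.length_cons, List.length_nil]
    ring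

theorem homEval_reverse (l : List ℝ) (x w : ℝ) : homEval l.reverse x w = homEval l w x := by
  induction l with
  | nil => rfl
  | cons a l ih =>
    rw [List.reverse_cons, homEval_append_singleton, ih, List.length_reverse, homEval]
    ring

theorem homEval_nonneg {l : List ℝ} (hl : ∀ a ∈ l, 0 ≤ a) {x w : ℝ} (hx : 0 ≤ x) (hw : 0 ≤ w) :
    0 ≤ homEval l x w := by
  induction l with
  | nil => exact le_rfl
  | cons a l ih =>
    have ha : 0 ≤ a := hl a (by simp)
    have hi : 0 ≤ homEval l x w := ih fun b hb => hl b (by simp [hb])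
    rw [homEval]
    positivity

theorem forall_mem_shiftCons {α : Type*} {op : α → α → α} {P : α → Prop}
    (hP : ∀ a b, P a → P b → P (op a b)) (s : List α) {a : α} (ha : P a)
    (hs : ∀ b ∈ s, P b) : ∀ b ∈ shiftCons op a s, P b := by
  induction s generalizing a with
  | nil => simpa [shiftCons] using ha
  | cons c s ih =>
    have hc : P c := hs c (by simp)
    have := ih hc fun b hb => hs b (by simp [hb])
    simp only [shiftCons, List.mem_cons]
    rintro b (rfl | hb)
    · exact hP _ _ ha hc
    · exact this b hb

theorem forall_mem_taylorShift {α : Type*} {op : α → α → α} {P : α → Prop}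
    (hP : ∀ a b, P a → P b → P (op a b)) (l : List α) (hl : ∀ a ∈ l, P a) :
    ∀ a ∈ taylorShift op l, P a := by
  induction l with
  | nil => simp [taylorShift]
  | cons a l ih =>
    exact forall_mem_shiftCons hP _ (hl a (by simp)) (ih fun b hb => hl b (by simp [hb]))

theorem map_shiftCons {α β : Type*} {op : α → α → α} {op' : β → β → β} {P : α → Prop}
    {φ : α → β} (hφ : ∀ a b, P a → P b → φ (op a b) = op' (φ a) (φ b)) (s : List α) {a : α}
    (ha : P a) (hs : ∀ b ∈ s, P b) :
    (shiftCons op a s).map φ = shiftCons op' (φ a) (s.map φ) := by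
  induction s generalizing a with
  | nil => rfl
  | cons c s ih =>
    have hc : P c := hs c (by simp)
    simp only [shiftCons, List.map_cons, hφ a c ha hc, ih hc fun b hb => hs b (by simp [hb])]

theorem map_taylorShift {α β : Type*} {op : α → α → α} {op' : β → β → β} {P : α → Prop}
    {φ : α → β} (hP : ∀ a b, P a → P b → P (op a b))
    (hφ : ∀ a b, P a → P b → φ (op a b) = op' (φ a) (φ b)) (l : List α)
    (hl : ∀ a ∈ l, P a) :
    (taylorShift op l).map φ = taylorShift op' (l.map φ) := by
  induction l with
  | nil => rfl
  | cons a l ih =>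
    have hl' : ∀ b ∈ l, P b := fun b hb => hl b (by simp [hb])
    change (shiftCons op a (taylorShift op l)).map φ = _
    rw [map_shiftCons hφ _ (hl a (by simp)) (forall_mem_taylorShift hP l hl'), ih hl']
    rfl

/-- Evaluation of an integer coefficient list. -/
def rowEval (r : List ℤ) (y v : ℝ) : ℝ := homEval (r.map (↑)) y v

/-- The bihomogeneous polynomial `∑ aᵢⱼ xⁱ w^(n-1-i) yʲ v^(k-1-j)` with coefficient rows `a`. -/
def gridEval (p : List (List ℤ)) (x w y v : ℝ) : ℝ := homEval (p.map (rowEval · y v)) x w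

/-- All rows of `p` have the same length. -/
def IsGrid (p : List (List ℤ)) (k : ℕ) : Prop := ∀ r ∈ p, r.length = k

/-- The shift `x ↦ x + w`. -/
def shiftX (p : List (List ℤ)) : List (List ℤ) := taylorShift (List.zipWith (· + ·)) p

/-- The shift `y ↦ y + v`. -/
def shiftY (p : List (List ℤ)) : List (List ℤ) := p.map (taylorShift (· + ·))

/-- The exchange of `y` and `v`. -/
def swapY (p : List (List ℤ)) : List (List ℤ) := p.map List.reverse

theorem rowEval_zipWith (r s : List ℤ) (h : r.length = s.length) (y v : ℝ) :
    rowEval (List.zipWith (· + ·) r s) y v = rowEval r y v + rowEval s y v := by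
  induction r generalizing s with
  | nil =>
    obtain rfl : s = [] := List.length_eq_zero_iff.mp h.symm
    simp [rowEval, homEval]
  | cons a r ih =>
    obtain _ | ⟨b, s⟩ := s
    · simp at h
    · have hrs : r.length = s.length := by simpa using h
      have := ih s hrs
      simp only [rowEval] at this
      simp only [rowEval, List.zipWith_cons_cons, List.map_cons, homEval, this, List.length_map,
        List.length_zipWith, hrs, min_self]
      push_cast
      ring

theorem rowEval_taylorShift (r : List ℤ) (y v : ℝ) :
    rowEval (taylorShift (· + ·) r) y v = rowEval r (y + v) v := by
  rw [rowEval, map_taylorShift (P := fun _ => True) (op' := (· + ·)) (by simp) (by simp) r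
    (by simp), homEval_taylorShift, rowEval]

theorem rowEval_reverse (r : List ℤ) (y v : ℝ) : rowEval r.reverse y v = rowEval r v y := by
  rw [rowEval, List.map_reverse, homEval_reverse, rowEval]

theorem IsGrid.shiftX {p : List (List ℤ)} {k : ℕ} (hp : IsGrid p k) : IsGrid (shiftX p) k :=
  forall_mem_taylorShift (op := List.zipWith (· + ·)) (P := fun r : List ℤ => r.length = k)
    (fun a b ha hb => by rw [List.length_zipWith, ha, hb, min_self]) p hp

theorem IsGrid.shiftY {p : List (List ℤ)} {k : ℕ} (hp : IsGrid p k) : IsGrid (shiftY p) k := by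
  simpa [IsGrid, _root_.shiftY, length_taylorShift] using hp

theorem IsGrid.swapY {p : List (List ℤ)} {k : ℕ} (hp : IsGrid p k) : IsGrid (swapY p) k := by
  intro s hs
  obtain ⟨r, hr, rfl⟩ := List.mem_map.1 hs
  rw [List.length_reverse, hp r hr]

theorem IsGrid.reverse {p : List (List ℤ)} {k : ℕ} (hp : IsGrid p k) : IsGrid p.reverse k :=
  fun r hr => hp r (List.mem_reverse.1 hr)

theorem gridEval_shiftX {p : List (List ℤ)} {k : ℕ} (hp : IsGrid p k) (x w y v : ℝ) :
    gridEval (shiftX p) x w y v = gridEval p (x + w) w y v := by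
  rw [gridEval, shiftX, map_taylorShift (P := fun r : List ℤ => r.length = k)
    (op' := (· + ·)) (fun a b ha hb => by rw [List.length_zipWith, ha, hb, min_self])
    (fun r s hr hs => rowEval_zipWith r s (hr.trans hs.symm) y v) p hp,
    homEval_taylorShift, gridEval]

theorem gridEval_shiftY (p : List (List ℤ)) (x w y v : ℝ) :
    gridEval (shiftY p) x w y v = gridEval p x w (y + v) v := by
  simp [gridEval, shiftY, Function.comp_def, rowEval_taylorShift]

theorem gridEval_swapY (p : List (List ℤ)) (x w y v : ℝ) :
    gridEval (swapY p) x w y v = gridEval p x w v y := by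
  simp [gridEval, swapY, Function.comp_def, rowEval_reverse]

theorem gridEval_reverse (p : List (List ℤ)) (x w y v : ℝ) :
    gridEval p.reverse x w y v = gridEval p w x y v := by
  rw [gridEval, List.map_reverse, homEval_reverse, gridEval]

/-- All coefficients are nonnegative. -/
def coeffsNonneg (p : List (List ℤ)) : Bool := p.all fun r => r.all fun c => decide (0 ≤ c)

theorem gridEval_nonneg_of_coeffsNonneg {p : List (List ℤ)} (hp : coeffsNonneg p = true)
    {x w y v : ℝ} (hx : 0 ≤ x) (hw : 0 ≤ w) (hy : 0 ≤ y) (hv : 0 ≤ v) :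
    0 ≤ gridEval p x w y v := by
  simp only [coeffsNonneg, List.all_eq_true, decide_eq_true_eq] at hp
  refine homEval_nonneg ?_ hx hw
  simp only [List.mem_map]
  rintro _ ⟨r, hr, rfl⟩
  refine homEval_nonneg ?_ hy hv
  simp only [List.mem_map]
  rintro _ ⟨c, hc, rfl⟩
  exact_mod_cast hp r hr c hc

/-- A subdivision test of depth `n` for nonnegativity on the nonnegative orthant: the orthant is
split along `x = w`, then along `y = v`, until all coefficients are nonnegative. -/
def orthantTest : ℕ → List (List ℤ) → Bool
  | 0, p => coeffsNonneg p
  | n + 1, p => coeffsNonneg p || [shiftX p, shiftX p.reverse].all fun q =>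
      coeffsNonneg q || (orthantTest n (shiftY q) && orthantTest n (shiftY (swapY q)))

theorem gridEval_nonneg_of_orthantTest {n : ℕ} {p : List (List ℤ)} {k : ℕ} (hp : IsGrid p k)
    (h : orthantTest n p = true) {x w y v : ℝ} (hx : 0 ≤ x) (hw : 0 ≤ w) (hy : 0 ≤ y)
    (hv : 0 ≤ v) : 0 ≤ gridEval p x w y v := by
  induction n generalizing p x w y v with
  | zero => exact gridEval_nonneg_of_coeffsNonneg h hx hw hy hv
  | succ n ih =>
    rw [orthantTest, Bool.or_eq_true] at h
    obtain h | h := h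
    · exact gridEval_nonneg_of_coeffsNonneg h hx hw hy hv
    have key : ∀ q, IsGrid q k →
        (coeffsNonneg q || (orthantTest n (shiftY q) && orthantTest n (shiftY (swapY q)))) = true →
        ∀ {x w : ℝ}, 0 ≤ x → 0 ≤ w → 0 ≤ gridEval q x w y v := by
      intro q hq h x w hx hw
      rw [Bool.or_eq_true, Bool.and_eq_true] at h
      obtain h | ⟨h₁, h₂⟩ := h
      · exact gridEval_nonneg_of_coeffsNonneg h hx hw hy hv
      obtain hyv | hyv := le_total v y
      · have := ih hq.shiftY h₁ hx hw (sub_nonneg.2 hyv) hv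
        rwa [gridEval_shiftY, sub_add_cancel] at this
      · have := ih hq.swapY.shiftY h₂ hx hw (sub_nonneg.2 hyv) hy
        rwa [gridEval_shiftY, sub_add_cancel, gridEval_swapY] at this
    simp only [List.all_cons, List.all_nil, Bool.and_true, Bool.and_eq_true] at h
    obtain hxw | hxw := le_total w x
    · have := key _ hp.shiftX h.1 (sub_nonneg.2 hxw) hw
      rwa [gridEval_shiftX hp, sub_add_cancel] at this
    · have := key _ hp.reverse.shiftX h.2 (sub_nonneg.2 hxw) hx
      rwa [gridEval_shiftX hp.reverse, sub_add_cancel, gridEval_reverse] at this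

/-- A test for nonnegativity on the unit square. -/
def squareTest (n : ℕ) (p : List (List ℤ)) : Bool :=
  orthantTest n (shiftY (swapY (shiftX p.reverse)))

theorem gridEval_nonneg_of_squareTest {n : ℕ} {p : List (List ℤ)} {k : ℕ} (hp : IsGrid p k)
    (h : squareTest n p = true) {x y : ℝ} (hx : x ∈ Icc 0 1) (hy : y ∈ Icc 0 1) :
    0 ≤ gridEval p x 1 y 1 := by
  have := gridEval_nonneg_of_orthantTest hp.reverse.shiftX.swapY.shiftY h (sub_nonneg.2 hx.2)
    hx.1 (sub_nonneg.2 hy.2) hy.1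
  rwa [gridEval_shiftY, gridEval_swapY, sub_add_cancel, gridEval_shiftX hp.reverse,
    sub_add_cancel, gridEval_reverse] at this

/-- The substitution `x ↦ x y`. -/
def blowUp : List (List ℤ) → List (List ℤ)
  | [] => []
  | r :: p => (r ++ List.replicate p.length 0) :: (blowUp p).map (0 :: ·)

/-- The substitution `x ↦ -x`. -/
def reflectX : List (List ℤ) → List (List ℤ)
  | [] => []
  | r :: p => r :: (reflectX p).map (List.map Neg.neg)

theorem rowEval_append_zeros (r : List ℤ) (n : ℕ) (y : ℝ) :
    rowEval (r ++ List.replicate n 0) y 1 = rowEval r y 1 := by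
  induction r with
  | nil =>
    induction n with
    | zero => rfl
    | succ n ih => simp_all [rowEval, homEval, List.replicate_succ]
  | cons a r ih => simp_all [rowEval, homEval]

theorem homEval_map_mul (l : List ℝ) (a x w : ℝ) :
    homEval (l.map (a * ·)) x w = a * homEval l x w := by
  induction l with
  | nil => simp [homEval]
  | cons b l ih =>
    simp only [List.map_cons, homEval, ih, List.length_map]
    ring

theorem gridEval_blowUp (p : List (List ℤ)) (x y : ℝ) :
    gridEval (blowUp p) x 1 y 1 = gridEval p (x * y) 1 y 1 := by
  induction p with
  | nil => rfl
  | cons r p ih =>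
    have h : ((blowUp p).map (0 :: ·)).map (rowEval · y 1) =
        ((blowUp p).map (rowEval · y 1)).map (y * ·) := by
      simp [rowEval, homEval]
    simp only [gridEval] at ih
    simp only [gridEval, blowUp, List.map_cons, h, homEval, homEval_map_mul, ih,
      rowEval_append_zeros, one_pow]
    ring

theorem gridEval_reflectX (p : List (List ℤ)) (x y : ℝ) :
    gridEval (reflectX p) x 1 y 1 = gridEval p (-x) 1 y 1 := by
  have hneg : ∀ r : List ℤ, rowEval (r.map Neg.neg) y 1 = -1 * rowEval r y 1 := by
    intro r
    rw [rowEval, rowEval, ← homEval_map_mul]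
    simp [Function.comp_def]
  induction p with
  | nil => rfl
  | cons r p ih =>
    have h : ((reflectX p).map (List.map Neg.neg)).map (rowEval · y 1) =
        ((reflectX p).map (rowEval · y 1)).map (-1 * ·) := by
      rw [List.map_map, List.map_map]
      exact List.map_congr_left fun r _ => hneg r
    simp only [gridEval] at ih
    simp only [gridEval, reflectX, List.map_cons, h, homEval, homEval_map_mul, ih, one_pow]
    ring

theorem IsGrid.blowUp {p : List (List ℤ)} {k : ℕ} (hp : IsGrid p k) :
    IsGrid (blowUp p) (k + (p.length - 1)) := by
  induction p with
  | nil => simp [IsGrid, _root_.blowUp]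
  | cons r p ih =>
    have hr : r.length = k := hp r (by simp)
    have hp' := ih fun s hs => hp s (by simp [hs])
    intro s hs
    simp only [_root_.blowUp, List.mem_cons, List.mem_map] at hs
    obtain rfl | ⟨t, ht, rfl⟩ := hs
    · simp [hr]
    · have h₁ := hp' t ht
      obtain _ | ⟨a, p⟩ := p
      · simp [_root_.blowUp] at ht
      · simp only [List.length_cons] at h₁ ⊢
        omega

theorem IsGrid.reflectX {p : List (List ℤ)} {k : ℕ} (hp : IsGrid p k) :
    IsGrid (reflectX p) k := by
  induction p with
  | nil => simp [IsGrid, _root_.reflectX]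
  | cons r p ih =>
    have hr : r.length = k := hp r (by simp)
    have hp' := ih fun s hs => hp s (by simp [hs])
    intro s hs
    simp only [_root_.reflectX, List.mem_cons, List.mem_map] at hs
    obtain rfl | ⟨t, ht, rfl⟩ := hs
    · exact hr
    · simpa using hp' t ht

theorem gridEval_nonneg_of_reflect {n : ℕ} {p : List (List ℤ)} {k : ℕ} (hp : IsGrid p k)
    (h₁ : squareTest n p = true) (h₂ : squareTest n (reflectX p) = true) {x y : ℝ}
    (hx : |x| ≤ 1) (hy : y ∈ Icc 0 1) : 0 ≤ gridEval p x 1 y 1 := by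
  obtain h0 | h0 := le_total 0 x
  · exact gridEval_nonneg_of_squareTest hp h₁ ⟨h0, (le_abs_self x).trans hx⟩ hy
  · have := gridEval_nonneg_of_squareTest hp.reflectX h₂ (x := -x)
      ⟨by linarith, (neg_le_abs x).trans hx⟩ hy
    rwa [gridEval_reflectX, neg_neg] at this

theorem gridEval_nonneg_of_blowUp {n : ℕ} {p : List (List ℤ)} {k : ℕ} (hp : IsGrid p k)
    (h₁ : squareTest n (blowUp p) = true) (h₂ : squareTest n (reflectX (blowUp p)) = true)
    {x y : ℝ} (hxy : |x| ≤ y) (hy : y ≤ 1) : 0 ≤ gridEval p x 1 y 1 := by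
  obtain rfl | hy0 := ((abs_nonneg x).trans hxy).eq_or_lt'
  · obtain rfl : x = 0 := abs_nonpos_iff.1 hxy
    have := gridEval_nonneg_of_reflect hp.blowUp h₁ h₂ (x := 0) (y := 0) (by simp) (by simp)
    rwa [gridEval_blowUp, zero_mul] at this
  · have := gridEval_nonneg_of_reflect hp.blowUp h₁ h₂ (x := x / y) (y := y)
      (by rwa [abs_div, abs_of_pos hy0, div_le_one hy0]) ⟨hy0.le, hy⟩
    rwa [gridEval_blowUp, div_mul_cancel₀ _ hy0.ne'] at this

/-! ### The polynomial inequalities -/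

/-- The radially averaged divergence of the multiplied field at `m = 3 / 5`, see
`hasDerivAt_lyapunov`. -/
def divPoly (x y : ℝ) : ℝ :=
  9 / 400 * y ^ 10 - 201 / 19600 * y ^ 12 + 4 / 125 * x * y ^ 9 + 117 / 700 * x * y ^ 11 -
  189 / 800 * x * y ^ 13 + 24 / 125 * x ^ 2 * y ^ 6 - 3509 / 5600 * x ^ 2 * y ^ 8 -
  2319 / 1400 * x ^ 2 * y ^ 10 + 3861 / 1600 * x ^ 2 * y ^ 12 + 251 / 2500 * x ^ 3 * y ^ 5 -
  589 / 375 * x ^ 3 * y ^ 7 + 6 * x ^ 3 * y ^ 9 - 1557 / 200 * x ^ 3 * y ^ 11 +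
  3 / 800 * x ^ 4 * y ^ 2 + 257 / 175 * x ^ 4 * y ^ 4 + 2347 / 600 * x ^ 4 * y ^ 6 -
  5679 / 1400 * x ^ 4 * y ^ 8 + 8811 / 800 * x ^ 4 * y ^ 10 - 181 / 250 * x ^ 5 * y ^ 3 -
  2011 / 200 * x ^ 5 * y ^ 5 + 84 / 25 * x ^ 5 * y ^ 7 - 1431 / 160 * x ^ 5 * y ^ 9 -
  61 / 200 * x ^ 6 * y ^ 2 + 269 / 120 * x ^ 6 * y ^ 4 - 177 / 25 * x ^ 6 * y ^ 6 +
  1107 / 800 * x ^ 6 * y ^ 8 + 1 / 4 * x ^ 7 * y + 19 / 2 * x ^ 7 * y ^ 3 +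
  7627 / 700 * x ^ 7 * y ^ 5 + 639 / 200 * x ^ 7 * y ^ 7 + 9 / 100 * x ^ 8 -
  201 / 40 * x ^ 8 * y ^ 2 - 111 / 40 * x ^ 8 * y ^ 4 - 651 / 400 * x ^ 8 * y ^ 6 -
  191 / 120 * x ^ 9 * y - 213 / 28 * x ^ 9 * y ^ 3 + 143 / 240 * x ^ 10 +
  341 / 70 * x ^ 10 * y ^ 2

/-- The coefficient of `(m - 3 / 5) * y ^ 4` in the factor of `hasDerivAt_lyapunov`. -/
def divSlope (x y : ℝ) : ℝ :=
  5 / 6 + 231 / 1000 * y ^ 4 + 11 / 60 * y ^ 6 + 143 / 3920 * y ^ 8 - 9 / 4 * x * y -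
  231 / 200 * x * y ^ 5 - 9 / 10 * x * y ^ 7 - 63 / 160 * x * y ^ 9 + 77 / 240 * x ^ 2 +
  21 / 5 * x ^ 2 * y ^ 2 + 33 / 280 * x ^ 2 * y ^ 4 + 957 / 280 * x ^ 2 * y ^ 6 +
  1287 / 320 * x ^ 2 * y ^ 8 - 77 / 50 * x ^ 3 * y - 1001 / 150 * x ^ 3 * y ^ 3 -
  41 / 14 * x ^ 3 * y ^ 5 - 519 / 40 * x ^ 3 * y ^ 7 + 11 / 140 * x ^ 4 +
  539 / 120 * x ^ 4 * y ^ 2 + 2907 / 280 * x ^ 4 * y ^ 4 + 2937 / 160 * x ^ 4 * y ^ 6 -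
  11 / 20 * x ^ 5 * y - 339 / 35 * x ^ 5 * y ^ 3 - 477 / 32 * x ^ 5 * y ^ 5 - 3 / 16 * x ^ 6 +
  63 / 40 * x ^ 6 * y ^ 2 + 369 / 160 * x ^ 6 * y ^ 4 + 27 / 20 * x ^ 7 * y +
  213 / 40 * x ^ 7 * y ^ 3 - 13 / 56 * x ^ 8 - 217 / 80 * x ^ 8 * y ^ 2

/-- `divPoly x y - (x ^ 8 + y ^ 10) / 10000` at `(8 x / 7, 8 y / 7)`, up to a positive factor. -/
def divGrid : List (List ℤ) :=
  [[0, 0, 0, 0, 0, 0, 0, 0, 0, 0, 108278273015808, 0, -64746631987200, 0],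
   [0, 0, 0, 0, 0, 0, 0, 0, 0, 154683247165440, 0, 1055273464627200, 0, -1948197165465600],
   [0, 0, 0, 0, 0, 0, 710576166666240, 0, -3028925861068800, 0, -10458030617395200, 0,
    19899442475827200, 0],
   [0, 0, 0, 0, 0, 371572120485888, 0, -7592369381703680, 0, 37881611550720000, 0,
    -64197735166771200, 0, 0],
   [0, 0, 10625681203200, 0, 5435061750988800, 0, 18908415682150400, 0, -25610675237683200, 0,
    90823096428134400, 0, 0, 0],
   [0, 0, 0, -2679464295137280, 0, -48604376570265600, 0, 21213702468403200, 0,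
    -73753178406912000, 0, 0, 0, 0],
   [0, 0, -1128779848089600, 0, 10835883720704000, 0, -44700301629849600, 0, 11410869112012800,
    0, 0, 0, 0, 0],
   [0, 925229383680000, 0, 45921589002240000, 0, 68791202689843200, 0, 26347047380582400, 0, 0,
    0, 0, 0, 0],
   [332712486371328, 0, -24290103656448000, 0, -17520245342208000, 0, -13420913806540800, 0, 0,
    0, 0, 0, 0, 0],
   [0, -7693880262656000, 0, -48028471787520000, 0, 0, 0, 0, 0, 0, 0, 0, 0, 0],
   [2880169836544000, 0, 30756260806656000, 0, 0, 0, 0, 0, 0, 0, 0, 0, 0, 0]]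

/-- The transpose of `divGrid`. -/
def divGridT : List (List ℤ) :=
  [[0, 0, 0, 0, 0, 0, 0, 0, 332712486371328, 0, 2880169836544000],
   [0, 0, 0, 0, 0, 0, 0, 925229383680000, 0, -7693880262656000, 0],
   [0, 0, 0, 0, 10625681203200, 0, -1128779848089600, 0, -24290103656448000, 0,
    30756260806656000],
   [0, 0, 0, 0, 0, -2679464295137280, 0, 45921589002240000, 0, -48028471787520000, 0],
   [0, 0, 0, 0, 5435061750988800, 0, 10835883720704000, 0, -17520245342208000, 0, 0],
   [0, 0, 0, 371572120485888, 0, -48604376570265600, 0, 68791202689843200, 0, 0, 0],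
   [0, 0, 710576166666240, 0, 18908415682150400, 0, -44700301629849600, 0, -13420913806540800, 0,
    0],
   [0, 0, 0, -7592369381703680, 0, 21213702468403200, 0, 26347047380582400, 0, 0, 0],
   [0, 0, -3028925861068800, 0, -25610675237683200, 0, 11410869112012800, 0, 0, 0, 0],
   [0, 154683247165440, 0, 37881611550720000, 0, -73753178406912000, 0, 0, 0, 0, 0],
   [108278273015808, 0, -10458030617395200, 0, 90823096428134400, 0, 0, 0, 0, 0, 0],
   [0, 1055273464627200, 0, -64197735166771200, 0, 0, 0, 0, 0, 0, 0],
   [-64746631987200, 0, 19899442475827200, 0, 0, 0, 0, 0, 0, 0, 0],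
   [0, -1948197165465600, 0, 0, 0, 0, 0, 0, 0, 0, 0]]

/-- `divSlope` at `(8 x / 7, 8 y / 7)`, up to a positive factor. -/
def slopeGrid : List (List ℤ) :=
  [[176547030625, 0, 0, 0, 83487495168, 0, 86543564800, 0, 22491955200, 0],
   [0, -622598508000, 0, 0, 0, -545224458240, 0, -554906419200, 0, -317089382400],
   [88777935400, 0, 1517954457600, 0, 55635148800, 0, 2107323187200, 0, 3238841548800, 0],
   [0, -556583301120, 0, -3150185758720, 0, -1805647872000, 0, -10448850124800, 0, 0],
   [28397107200, 0, 2120317337600, 0, 6401241907200, 0, 14782405017600, 0, 0, 0],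
   [0, -259630694400, 0, -5971850035200, 0, -12004098048000, 0, 0, 0, 0],
   [-88510464000, 0, 971086233600, 0, 1857237811200, 0, 0, 0, 0, 0],
   [0, 832359628800, 0, 4288256409600, 0, 0, 0, 0, 0, 0],
   [-143130624000, 0, -2184393523200, 0, 0, 0, 0, 0, 0, 0]]

theorem le_divPoly {x y : ℝ} (hx : |x| ≤ 8 / 7) (hy : |y| ≤ 8 / 7) :
    (x ^ 8 + y ^ 10) / 10000 ≤ divPoly x y := by
  let f : ℝ → ℝ → ℝ := fun x y =>
    1271668261591875 * (divPoly (8 / 7 * x) (8 / 7 * y) -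
      ((8 / 7 * x) ^ 8 + (8 / 7 * y) ^ 10) / 10000)
  have hf : ∀ x y, f (-x) (-y) = f x y := fun x y => by
    simp only [f, divPoly]
    ring
  have h₁ : ∀ x y, |x| ≤ y → y ≤ 1 → 0 ≤ f x y := fun x y hxy hy => by
    have hp : IsGrid divGrid 14 := by simp [IsGrid, divGrid]
    have := gridEval_nonneg_of_blowUp (n := 3) hp (by decide +kernel) (by decide +kernel) hxy hy
    simp only [gridEval, divGrid, rowEval, homEval, List.map, List.length] at this
    push_cast at this
    simp only [f, divPoly]
    linear_combination this
  have h₂ : ∀ x y, |y| ≤ x → x ≤ 1 → 0 ≤ f x y := fun x y hxy hx => by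
    have hp : IsGrid divGridT 11 := by simp [IsGrid, divGridT]
    have := gridEval_nonneg_of_blowUp (n := 3) hp (by decide +kernel) (by decide +kernel) hxy hx
    simp only [gridEval, divGridT, rowEval, homEval, List.map, List.length] at this
    push_cast at this
    simp only [f, divPoly]
    linear_combination this
  have := nonneg_of_even_of_cones hf h₁ h₂ (x := 7 / 8 * x) (y := 7 / 8 * y)
    (by rw [abs_mul, abs_of_pos (by norm_num)]; linarith)
    (by rw [abs_mul, abs_of_pos (by norm_num)]; linarith)
  simp only [f] at this
  ring_nf at this ⊢
  linarith

theorem divSlope_nonneg {x y : ℝ} (hx : |x| ≤ 8 / 7) (hy : |y| ≤ 8 / 7) : 0 ≤ divSlope x y := by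
  let f : ℝ → ℝ → ℝ := fun x y => 211856436750 * divSlope (8 / 7 * x) (8 / 7 * y)
  have hf : ∀ x y, f (-x) (-y) = f x y := fun x y => by
    simp only [f, divSlope]
    ring
  have h : ∀ x y, |x| ≤ 1 → y ∈ Icc 0 1 → 0 ≤ f x y := fun x y hx hy => by
    have hp : IsGrid slopeGrid 10 := by simp [IsGrid, slopeGrid]
    have := gridEval_nonneg_of_reflect (n := 1) hp (by decide +kernel) (by decide +kernel) hx hy
    simp only [gridEval, slopeGrid, rowEval, homEval, List.map, List.length] at this
    push_cast at this
    simp only [f, divSlope]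
    linear_combination this
  have := nonneg_of_even hf h (x := 7 / 8 * x) (y := 7 / 8 * y)
    (by rw [abs_mul, abs_of_pos (by norm_num)]; linarith)
    (by rw [abs_mul, abs_of_pos (by norm_num)]; linarith)
  simp only [f] at this
  ring_nf at this ⊢
  linarith

theorem angular_one_third_nonneg {x y : ℝ} (hx : |x| ≤ 1) (hy : |y| ≤ 1) :
    0 ≤ x ^ 2 - x * y ^ 5 + 1 / 3 * (y ^ 4 - x ^ 3 * y) := by
  let p : List (List ℤ) :=
    [[0, 0, 0, 0, 1, 0], [0, 0, 0, 0, 0, -3], [3, 0, 0, 0, 0, 0], [0, -1, 0, 0, 0, 0]]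
  have hp : IsGrid p 6 := by simp [IsGrid, p]
  refine nonneg_of_even (f := fun x y => x ^ 2 - x * y ^ 5 + 1 / 3 * (y ^ 4 - x ^ 3 * y))
    (fun x y => by ring) (fun x y hx hy => ?_) hx hy
  have := gridEval_nonneg_of_reflect (n := 6) hp (by decide +kernel) (by decide +kernel) hx hy
  simp only [gridEval, p, rowEval, homEval, List.map, List.length] at this
  push_cast at this
  linear_combination this / 3

theorem angular_four_thirds_nonneg {x y : ℝ} (hx : |x| ≤ 1) (hy : |y| ≤ 1) :
    0 ≤ x ^ 2 - x * y ^ 5 + 4 / 3 * (y ^ 4 - x ^ 3 * y) := by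
  let p : List (List ℤ) :=
    [[0, 0, 0, 0, 4, 0], [0, 0, 0, 0, 0, -3], [3, 0, 0, 0, 0, 0], [0, -4, 0, 0, 0, 0]]
  have hp : IsGrid p 6 := by simp [IsGrid, p]
  refine nonneg_of_even (f := fun x y => x ^ 2 - x * y ^ 5 + 4 / 3 * (y ^ 4 - x ^ 3 * y))
    (fun x y => by ring) (fun x y hx hy => ?_) hx hy
  have := gridEval_nonneg_of_reflect (n := 6) hp (by decide +kernel) (by decide +kernel) hx hy
  simp only [gridEval, p, rowEval, homEval, List.map, List.length] at this
  push_cast at this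
  linear_combination this / 3

theorem multiplier_linear_nonneg {x y : ℝ} (hx : |x| ≤ 1) (hy : |y| ≤ 1) :
    0 ≤ 400 * y ^ 4 + 7 * x ^ 2 - 371 * x * y ^ 5 + 322 * y ^ 10 := by
  let p : List (List ℤ) :=
    [[0, 0, 0, 0, 400, 0, 0, 0, 0, 0, 322], [0, 0, 0, 0, 0, -371, 0, 0, 0, 0, 0],
      [7, 0, 0, 0, 0, 0, 0, 0, 0, 0, 0]]
  have hp : IsGrid p 11 := by simp [IsGrid, p]
  refine nonneg_of_even (f := fun x y => 400 * y ^ 4 + 7 * x ^ 2 - 371 * x * y ^ 5 + 322 * y ^ 10)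
    (fun x y => by ring) (fun x y hx hy => ?_) hx hy
  have := gridEval_nonneg_of_reflect (n := 1) hp (by decide +kernel) (by decide +kernel) hx hy
  simp only [gridEval, p, rowEval, homEval, List.map, List.length] at this
  push_cast at this
  linear_combination this / 1

theorem multiplier_quadratic_nonneg {x y : ℝ} (hx : |x| ≤ 1) (hy : |y| ≤ 1) :
    0 ≤ 3559 * y ^ 4 + 140 * x ^ 2 - 7420 * x * y ^ 5 + 6440 * y ^ 10 +
      441 * x ^ 3 * y := by
  let p : List (List ℤ) :=
    [[0, 0, 0, 0, 3559, 0, 0, 0, 0, 0, 6440], [0, 0, 0, 0, 0, -7420, 0, 0, 0, 0, 0],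
      [140, 0, 0, 0, 0, 0, 0, 0, 0, 0, 0], [0, 441, 0, 0, 0, 0, 0, 0, 0, 0, 0]]
  have hp : IsGrid p 11 := by simp [IsGrid, p]
  refine nonneg_of_even (f := fun x y => 3559 * y ^ 4 + 140 * x ^ 2 - 7420 * x * y ^ 5 +
      6440 * y ^ 10 + 441 * x ^ 3 * y)
    (fun x y => by ring) (fun x y hx hy => ?_) hx hy
  have := gridEval_nonneg_of_reflect (n := 1) hp (by decide +kernel) (by decide +kernel) hx hy
  simp only [gridEval, p, rowEval, homEval, List.map, List.length] at this
  push_cast at this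
  linear_combination this / 1

/-! ### Periodic and heteroclinic orbits -/

/-- Solutions that are periodic or connect `pMinus m` to `pPlus m`. -/
def IsPeriodicOrConnecting (m : ℝ) (γ : ℝ → ℝ × ℝ) : Prop :=
  (IsSolution m γ ∧ ∃ T, 0 < T ∧ Function.Periodic γ T) ∨ IsHeteroclinic m γ

theorem IsPeriodicOrConnecting.isSolution {m : ℝ} {γ : ℝ → ℝ × ℝ}
    (h : IsPeriodicOrConnecting m γ) : IsSolution m γ :=
  h.elim And.left And.left

theorem IsSolution.hasDerivAt_fst_s15 {m : ℝ} {γ : ℝ → ℝ × ℝ} (h : IsSolution m γ) (t : ℝ) :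
    HasDerivAt (fun t => (γ t).1) ((γ t).2 ^ 3 - (γ t).1 ^ 3) t :=
  (ContinuousLinearMap.fst ℝ ℝ ℝ).hasFDerivAt.comp_hasDerivAt t (h t)

theorem IsSolution.hasDerivAt_snd_s15 {m : ℝ} {γ : ℝ → ℝ × ℝ} (h : IsSolution m γ) (t : ℝ) :
    HasDerivAt (fun t => (γ t).2) (-(γ t).1 + m * (γ t).2 ^ 5) t :=
  (ContinuousLinearMap.snd ℝ ℝ ℝ).hasFDerivAt.comp_hasDerivAt t (h t)

theorem IsSolution.continuous_s15 {m : ℝ} {γ : ℝ → ℝ × ℝ} (h : IsSolution m γ) : Continuous γ :=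
  continuous_iff_continuousAt.2 fun t => (h t).continuousAt

theorem IsSolution.eq_const {m : ℝ} {γ : ℝ → ℝ × ℝ} (h : IsSolution m γ)
    (h0 : ∀ t, bacciotti m (γ t) = 0) : ∃ c, ∀ t, γ t = c :=
  ⟨γ 0, fun t => is_const_of_deriv_eq_zero (fun t => (h t).differentiableAt)
    (fun t => (h t).deriv.trans (h0 t)) t 0⟩

/-- A nondecreasing observable taking the same value at both saddles is constant along the orbit. -/
theorem IsPeriodicOrConnecting.derivative_eq_zero {m : ℝ} {γ : ℝ → ℝ × ℝ}
    (h : IsPeriodicOrConnecting m γ) {V : ℝ × ℝ → ℝ} (hV : Continuous V)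
    (hpm : V (pMinus m) = V (pPlus m)) {D : ℝ → ℝ}
    (hD : ∀ t, HasDerivAt (fun t => V (γ t)) (D t) t) (hD0 : ∀ t, 0 ≤ D t) (t : ℝ) : D t = 0 := by
  have hmono : Monotone fun t => V (γ t) :=
    monotone_of_deriv_nonneg (fun t => (hD t).differentiableAt) fun t => by
      rw [(hD t).deriv]
      exact hD0 t
  suffices hc : ∃ c, ∀ t, V (γ t) = c by
    obtain ⟨c, hc⟩ := hc
    have hD' := hD t
    rw [funext hc] at hD'
    exact hD'.unique (hasDerivAt_const t c)
  obtain ⟨-, T, hT, hper⟩ | ⟨-, hbot, htop⟩ := h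
  · have hle : ∀ s t, V (γ t) ≤ V (γ s) := fun s t => by
      obtain ⟨n, hn⟩ := exists_nat_ge ((t - s) / T)
      have hn' : t ≤ s + n * T := by
        rw [div_le_iff₀ hT] at hn
        linarith
      exact (hmono hn').trans_eq (congrArg V (hper.nat_mul n s))
    exact ⟨V (γ 0), fun t => le_antisymm (hle 0 t) (hle t 0)⟩
  · refine ⟨V (pPlus m), fun t => le_antisymm ?_ ?_⟩
    · exact hmono.ge_of_tendsto ((hV.tendsto _).comp htop) t
    · rw [← hpm]
      exact hmono.le_of_tendsto ((hV.tendsto _).comp hbot) t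

theorem IsPeriodicOrConnecting.exists_max {m : ℝ} {γ : ℝ → ℝ × ℝ}
    (h : IsPeriodicOrConnecting m γ) {f : ℝ × ℝ → ℝ} (hf : Continuous f) {t₀ : ℝ}
    (hm : f (pMinus m) < f (γ t₀)) (hp : f (pPlus m) < f (γ t₀)) :
    ∃ s, ∀ t, f (γ t) ≤ f (γ s) := by
  have hc : Continuous fun t => f (γ t) := hf.comp h.isSolution.continuous_s15
  obtain ⟨-, T, hT, hper⟩ | ⟨-, hbot, htop⟩ := h
  · obtain ⟨s, -, hs⟩ := isCompact_Icc.exists_isMaxOn (nonempty_Icc.2 hT.le) hc.continuousOn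
    refine ⟨s, fun t => ?_⟩
    obtain ⟨r, hr, hrt⟩ := hper.exists_mem_Ico₀ hT t
    rw [hrt]
    exact hs (Ico_subset_Icc_self hr)
  · refine hc.exists_forall_ge' t₀ ?_
    rw [cocompact_eq_atBot_atTop, eventually_sup]
    exact ⟨((hf.tendsto _).comp hbot).eventually_le_const hm,
      ((hf.tendsto _).comp htop).eventually_le_const hp⟩

theorem exists_pPlus_eq {m : ℝ} (hm : 0 < m) :
    ∃ c, 0 < c ∧ m * c ^ 4 = 1 ∧ pPlus m = (c, c) ∧ pMinus m = (-c, -c) := by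
  refine ⟨m ^ (-(1 : ℝ) / 4), rpow_pos_of_pos hm _, ?_, rfl, rfl⟩
  rw [← rpow_natCast, ← rpow_mul hm.le]
  norm_num [rpow_neg_one, ne_of_gt hm]

/-- The orbits stay in the box with corners at the saddles. -/
theorem IsPeriodicOrConnecting.sq_le {m c : ℝ} (hm : 0 < m) (hmc : m * c ^ 4 = 1)
    (hp : pPlus m = (c, c)) (hp' : pMinus m = (-c, -c)) {γ : ℝ → ℝ × ℝ}
    (h : IsPeriodicOrConnecting m γ) (t : ℝ) : (γ t).1 ^ 2 ≤ c ^ 2 ∧ (γ t).2 ^ 2 ≤ c ^ 2 := by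
  have hx : ∀ t₀, c ^ 2 < (γ t₀).1 ^ 2 → ∃ s, (∀ t, (γ t).1 ^ 2 ≤ (γ s).1 ^ 2) ∧
      (γ s).1 = (γ s).2 := fun t₀ ht₀ => by
    obtain ⟨s, hs⟩ := h.exists_max (f := fun p => p.1 ^ 2) (t₀ := t₀) (by fun_prop)
      (by simpa [hp'] using ht₀) (by simpa [hp] using ht₀)
    refine ⟨s, hs, ?_⟩
    have hd := IsLocalMax.hasDerivAt_eq_zero (f := fun t => (γ t).1 ^ 2) (.of_forall hs)
      ((h.isSolution.hasDerivAt_fst_s15 s).pow 2)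
    have hne : (γ s).1 ≠ 0 := fun h0 => by
      have := hs t₀
      simp only [h0] at this
      nlinarith [sq_nonneg c]
    have : (γ s).2 ^ 3 - (γ s).1 ^ 3 = 0 := by simpa [hne] using hd
    exact (Odd.strictMono_pow (n := 3) (by decide)).injective (sub_eq_zero.1 this).symm
  have hy : ∀ t, (γ t).2 ^ 2 ≤ c ^ 2 := by
    by_contra! hcon
    obtain ⟨t₀, ht₀⟩ := hcon
    obtain ⟨s, hs⟩ := h.exists_max (f := fun p => p.2 ^ 2) (t₀ := t₀) (by fun_prop)
      (by simpa [hp'] using ht₀) (by simpa [hp] using ht₀)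
    have hd := IsLocalMax.hasDerivAt_eq_zero (f := fun t => (γ t).2 ^ 2) (.of_forall hs)
      ((h.isSolution.hasDerivAt_snd_s15 s).pow 2)
    have hcs : c ^ 2 < (γ s).2 ^ 2 := ht₀.trans_le (hs t₀)
    have hne : (γ s).2 ≠ 0 := fun h0 => by
      simp only [h0] at hcs
      nlinarith [sq_nonneg c]
    have hxs : -(γ s).1 + m * (γ s).2 ^ 5 = 0 := by simpa [hne] using hd
    have hone : 1 < m * (γ s).2 ^ 4 := by
      rw [← hmc]
      refine mul_lt_mul_of_pos_left ?_ hm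
      nlinarith [sq_nonneg c]
    have hlt : (γ s).2 ^ 2 < (γ s).1 ^ 2 := by
      have : (γ s).1 ^ 2 = (m * (γ s).2 ^ 4) ^ 2 * (γ s).2 ^ 2 := by
        rw [show (γ s).1 = m * (γ s).2 ^ 5 by linarith]
        ring
      rw [this]
      exact lt_mul_of_one_lt_left (by positivity) (one_lt_pow₀ hone two_ne_zero)
    obtain ⟨r, hr, hrr⟩ := hx s (hcs.trans hlt)
    have h₁ := hr s
    have h₂ := hs r
    simp only [hrr] at h₁ h₂
    linarith
  refine ⟨?_, hy t⟩
  by_contra! hcon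
  obtain ⟨s, hs, hss⟩ := hx t hcon
  have := hy s
  rw [← hss] at this
  linarith [hs t]

/-- Rescaled coordinates in which the saddles are at `(1, 1)` and `(-1, -1)`. -/
theorem IsPeriodicOrConnecting.exists_scaled {m c : ℝ} (hm : 0 < m) (hc : 0 < c)
    (hmc : m * c ^ 4 = 1) (hp : pPlus m = (c, c)) (hp' : pMinus m = (-c, -c)) {γ : ℝ → ℝ × ℝ}
    (h : IsPeriodicOrConnecting m γ) (t : ℝ) :
    ∃ X Y : ℝ, |X| ≤ 1 ∧ |Y| ≤ 1 ∧ (γ t).1 = c * X ∧ (γ t).2 = c * Y := by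
  obtain ⟨hx, hy⟩ := h.sq_le hm hmc hp hp' t
  refine ⟨(γ t).1 / c, (γ t).2 / c, ?_, ?_, by field_simp, by field_simp⟩
  · rw [abs_div, abs_of_pos hc, div_le_one hc]
    exact abs_le_of_sq_le_sq hx hc.le
  · rw [abs_div, abs_of_pos hc, div_le_one hc]
    exact abs_le_of_sq_le_sq hy hc.le

/-! ### The case of large `m` -/

/-- Positivity of the multiplier in the derivative of the Lyapunov function used for large `m`. -/
theorem multiplier_nonneg {X Y l : ℝ} (hX : |X| ≤ 1) (hY : |Y| ≤ 1) (hl : 0 < l)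
    (hl' : l < 7 / 20) {M : ℝ}
    (hM : M = 5 * Y ^ 4 + l * (1 / 2 * X ^ 2 - 53 / 2 * X * Y ^ 5 + 23 * Y ^ 10) +
      l ^ 2 * (9 / 2 * (X ^ 3 * Y - Y ^ 4))) : 0 ≤ M ∧ (M = 0 → X = 0 ∧ Y = 0) := by
  have h₁ := multiplier_linear_nonneg hX hY
  have h₂ := multiplier_quadratic_nonneg hX hY
  have h₀ : 0 ≤ Y ^ 4 := by positivity
  have hw : 0 < 7 / 20 - l := by linarith
  have key : (7 / 20) ^ 2 * M = 5 * (7 / 20 - l) ^ 2 * Y ^ 4 +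
      l * (7 / 20 - l) / 40 * (400 * Y ^ 4 + 7 * X ^ 2 - 371 * X * Y ^ 5 + 322 * Y ^ 10) +
      l ^ 2 / 800 * (3559 * Y ^ 4 + 140 * X ^ 2 - 7420 * X * Y ^ 5 + 6440 * Y ^ 10 +
        441 * X ^ 3 * Y) := by
    rw [hM]
    ring
  have t₀ := mul_nonneg (by positivity : 0 ≤ 5 * (7 / 20 - l) ^ 2) h₀
  have t₁ := mul_nonneg (by positivity : 0 ≤ l * (7 / 20 - l) / 40) h₁
  have t₂ := mul_nonneg (by positivity : 0 ≤ l ^ 2 / 800) h₂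
  refine ⟨by linarith, fun h0 => ?_⟩
  rw [h0, mul_zero] at key
  have e₀ : 5 * (7 / 20 - l) ^ 2 * Y ^ 4 = 0 := by linarith
  have e₁ : l * (7 / 20 - l) / 40 *
      (400 * Y ^ 4 + 7 * X ^ 2 - 371 * X * Y ^ 5 + 322 * Y ^ 10) = 0 := by linarith
  have hY0 : Y = 0 := by simpa [hw.ne'] using e₀
  subst hY0
  exact ⟨by simpa [hw.ne', hl.ne'] using e₁, rfl⟩

theorem IsPeriodicOrConnecting.bacciotti_eq_zero_of_large {m : ℝ} (hm : 17 / 2 ≤ m)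
    {γ : ℝ → ℝ × ℝ} (h : IsPeriodicOrConnecting m γ) (t : ℝ) : bacciotti m (γ t) = 0 := by
  have hm0 : 0 < m := by linarith
  obtain ⟨c, hc, hmc, hp, hp'⟩ := exists_pPlus_eq hm0
  have hl : c ^ 2 < 7 / 20 := by nlinarith [sq_nonneg c, pow_pos hc 4]
  let V : ℝ × ℝ → ℝ := fun p => (p.1 - m * p.2 ^ 5) ^ 2 / 2 + p.2 ^ 4 / 4 -
    m ^ 3 * p.2 ^ 16 / 16 - 3 / 2 * p.2 * (p.1 - m * p.2 ^ 5) ^ 3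
  let M : ℝ × ℝ → ℝ := fun p => 5 * (m * p.2 ^ 4) - p.1 ^ 2 - m * p.1 * p.2 ^ 5 - m ^ 2 * p.2 ^ 10 +
    3 / 2 * (p.1 - m * p.2 ^ 5) ^ 2 - 9 / 2 * p.2 ^ 4 + 9 / 2 * p.1 ^ 3 * p.2 -
    45 / 2 * (m * p.2 ^ 5) * (p.1 - m * p.2 ^ 5)
  have hV : ∀ t, HasDerivAt (fun t => V (γ t))
      (((γ t).1 - m * (γ t).2 ^ 5) ^ 2 * M (γ t)) t := fun t => by
    have hx := h.isSolution.hasDerivAt_fst_s15 t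
    have hy := h.isSolution.hasDerivAt_snd_s15 t
    have hu := hx.sub ((hy.pow 5).const_mul m)
    refine (((((hu.pow 2).div_const 2).add ((hy.pow 4).div_const 4)).sub
      (((hy.pow 16).const_mul (m ^ 3)).div_const 16)).sub
      ((hy.const_mul (3 / 2)).mul (hu.pow 3))).congr_deriv ?_
    simp only [M, Pi.sub_apply, Pi.pow_apply]
    push_cast
    ring
  have hM : ∀ t, 0 ≤ M (γ t) ∧ (M (γ t) = 0 → (γ t).1 = 0 ∧ (γ t).2 = 0) := fun t => by
    obtain ⟨X, Y, hX, hY, hx, hy⟩ := h.exists_scaled hm0 hc hmc hp hp' t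
    have := multiplier_nonneg hX hY (pow_pos hc 2) hl (M := M (γ t)) (by
      simp only [M, hx, hy]
      linear_combination (5 * Y ^ 4 - c ^ 2 * X * Y ^ 5 - c ^ 2 * Y ^ 10 * (m * c ^ 4 + 1) +
        3 / 2 * c ^ 2 * (-2 * X * Y ^ 5 + Y ^ 10 * (m * c ^ 4 + 1)) -
        45 / 2 * c ^ 2 * (X * Y ^ 5 - Y ^ 10 * (m * c ^ 4 + 1))) * hmc)
    exact ⟨this.1, fun h0 => by simpa [hx, hy] using
      ⟨Or.inr (a := c = 0) (this.2 h0).1, Or.inr (a := c = 0) (this.2 h0).2⟩⟩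
  have hu : ∀ t, (γ t).1 - m * (γ t).2 ^ 5 = 0 := fun t => by
    have h0 := h.derivative_eq_zero (V := V) (by fun_prop) (by simp only [V, hp, hp']; ring) hV
      (fun t => mul_nonneg (sq_nonneg _) (hM t).1) t
    obtain h0 | h0 := mul_eq_zero.1 h0
    · exact pow_eq_zero_iff two_ne_zero |>.1 h0
    · obtain ⟨hx, hy⟩ := (hM t).2 h0
      simp [hx, hy]
  have hx := h.isSolution.hasDerivAt_fst_s15 t
  have hy := h.isSolution.hasDerivAt_snd_s15 t
  have hd := hx.sub ((hy.pow 5).const_mul m)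
  have hd0 := (hasDerivAt_const t (0 : ℝ)).congr_of_eventuallyEq
    (.of_forall hu) |>.unique hd
  have h2 : -(γ t).1 + m * (γ t).2 ^ 5 = 0 := by linarith [hu t]
  rw [h2] at hd0
  exact Prod.ext (by simpa [bacciotti] using hd0.symm) h2

/-! ### The case of moderate `m` -/

/-- The clockwise angular momentum `y * dx/dt - x * dy/dt` along the flow. -/
def angular (m x y : ℝ) : ℝ := x ^ 2 + y ^ 4 - x ^ 3 * y - m * x * y ^ 5

/-- The integral along rays of the one-form dual to `x ^ i * y ^ j * X_m`. -/
def lyapunovMonomial (m : ℝ) (i j : ℕ) (x y : ℝ) : ℝ :=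
  x ^ i * y ^ j * (x ^ 2 / (i + j + 2) + y ^ 4 / (i + j + 4) - x ^ 3 * y / (i + j + 4) -
    m * x * y ^ 5 / (i + j + 6))

/-- The factor of `angular` in the derivative of `lyapunovMonomial m i j` along the flow: the
radial average of the divergence of `x ^ i * y ^ j * X_m`. -/
def divMonomial (m : ℝ) (i j : ℕ) (x y : ℝ) : ℝ :=
  m * (j + 5) * x ^ i * y ^ (j + 4) / (i + j + 6) +
    (i * x ^ (i - 1) * y ^ (j + 3) - (i + 3) * x ^ (i + 2) * y ^ j) / (i + j + 4) -
    j * x ^ (i + 1) * y ^ (j - 1) / (i + j + 2)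

theorem hasDerivAt_lyapunovMonomial {m : ℝ} (i j : ℕ) {x y : ℝ → ℝ} {t : ℝ}
    (hx : HasDerivAt x (y t ^ 3 - x t ^ 3) t) (hy : HasDerivAt y (-x t + m * y t ^ 5) t) :
    HasDerivAt (fun t => lyapunovMonomial m i j (x t) (y t))
      (angular m (x t) (y t) * divMonomial m i j (x t) (y t)) t := by
  have h₂ : (i + j + 2 : ℝ) ≠ 0 := by positivity
  have h₄ : (i + j + 4 : ℝ) ≠ 0 := by positivity
  have h₆ : (i + j + 6 : ℝ) ≠ 0 := by positivity
  refine (((hx.pow i).mul (hy.pow j)).mul (((((hx.pow 2).div_const _).add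
    ((hy.pow 4).div_const _)).sub (((hx.pow 3).mul hy).div_const _)).sub
    (((hx.const_mul m).mul (hy.pow 5)).div_const _))).congr_deriv ?_
  simp only [angular, divMonomial, Pi.mul_apply, Pi.pow_apply, Pi.sub_apply, Pi.add_apply]
  cases i <;> cases j <;> simp only [Nat.add_sub_cancel, Nat.zero_sub] <;> push_cast at * <;>
    field_simp <;> ring

/-- Exponents `i`, `j` and coefficients of the polynomial multiplying the vector field. -/
def factorTerms : List (ℕ × ℕ × ℝ) :=
  [(0, 0, 1), (0, 4, 77 / 300), (0, 6, 1 / 5), (0, 8, 11 / 280), (1, 1, -3), (1, 5, -693 / 500),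
    (1, 7, -21 / 20), (1, 9, -9 / 20), (2, 0, 77 / 150), (2, 2, 6), (2, 4, 11 / 70),
    (2, 6, 87 / 20), (2, 8, 99 / 20), (3, 1, -77 / 30), (3, 3, -1001 / 100), (3, 5, -41 / 10),
    (3, 7, -173 / 10), (4, 0, 11 / 70), (4, 2, 77 / 10), (4, 4, 323 / 20), (4, 6, 267 / 10),
    (5, 1, -11 / 10), (5, 3, -339 / 20), (5, 5, -477 / 20), (6, 0, -9 / 20), (6, 2, 63 / 20),
    (6, 4, 41 / 10), (7, 1, 63 / 20), (7, 3, 213 / 20), (8, 0, -13 / 20), (8, 2, -31 / 5)]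

/-- A Lyapunov function for moderate `m`. -/
def lyapunov (m x y : ℝ) : ℝ :=
  (factorTerms.map fun a => a.2.2 * lyapunovMonomial m a.1 a.2.1 x y).sum

theorem sum_divMonomial (m x y : ℝ) :
    (factorTerms.map fun a => a.2.2 * divMonomial m a.1 a.2.1 x y).sum =
      divPoly x y + (m - 3 / 5) * y ^ 4 * divSlope x y := by
  simp only [factorTerms, divMonomial, divPoly, divSlope, List.map, List.sum_cons, List.sum_nil]
  push_cast
  norm_num only [Nat.add_sub_cancel]
  ring

theorem lyapunov_neg_neg (m x y : ℝ) : lyapunov m (-x) (-y) = lyapunov m x y := by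
  simp only [factorTerms, lyapunov, lyapunovMonomial, List.map, List.sum_cons, List.sum_nil]
  ring

theorem continuous_lyapunov (m : ℝ) : Continuous fun p : ℝ × ℝ => lyapunov m p.1 p.2 := by
  unfold lyapunov lyapunovMonomial
  exact continuous_list_sum _ fun a _ => by fun_prop

theorem hasDerivAt_lyapunov {m : ℝ} {x y : ℝ → ℝ} {t : ℝ}
    (hx : HasDerivAt x (y t ^ 3 - x t ^ 3) t) (hy : HasDerivAt y (-x t + m * y t ^ 5) t) :
    HasDerivAt (fun t => lyapunov m (x t) (y t)) (angular m (x t) (y t) *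
      (divPoly (x t) (y t) + (m - 3 / 5) * y t ^ 4 * divSlope (x t) (y t))) t := by
  rw [← sum_divMonomial]
  unfold lyapunov
  induction factorTerms with
  | nil => simpa using hasDerivAt_const t (0 : ℝ)
  | cons a l ih =>
    simp only [List.map_cons, List.sum_cons]
    refine (((hasDerivAt_lyapunovMonomial a.1 a.2.1 hx hy).const_mul a.2.2).add ih).congr_deriv ?_
    ring

theorem angular_nonneg {X Y l : ℝ} (hX : |X| ≤ 1) (hY : |Y| ≤ 1) (hl : 1 / 3 < l)
    (hl' : l < 4 / 3) {q : ℝ} (hq : q = l * (X ^ 2 - X * Y ^ 5 + l * (Y ^ 4 - X ^ 3 * Y))) :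
    0 ≤ q ∧ (q = 0 → Y ^ 3 = X ^ 3 ∧ X = Y ^ 5) := by
  have h₁ := angular_one_third_nonneg hX hY
  have h₂ := angular_four_thirds_nonneg hX hY
  have hw₁ : 0 < 4 / 3 - l := by linarith
  have hw₂ : 0 < l - 1 / 3 := by linarith
  have hl0 : 0 < l := by linarith
  have t₁ := mul_nonneg hw₁.le h₁
  have t₂ := mul_nonneg hw₂.le h₂
  have key : X ^ 2 - X * Y ^ 5 + l * (Y ^ 4 - X ^ 3 * Y) =
      (4 / 3 - l) * (X ^ 2 - X * Y ^ 5 + 1 / 3 * (Y ^ 4 - X ^ 3 * Y)) +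
      (l - 1 / 3) * (X ^ 2 - X * Y ^ 5 + 4 / 3 * (Y ^ 4 - X ^ 3 * Y)) := by ring
  rw [key] at hq
  refine ⟨hq ▸ by positivity, fun h0 => ?_⟩
  have hsum := (mul_eq_zero.1 (hq.symm.trans h0)).resolve_left hl0.ne'
  have e₁ := (mul_eq_zero.1 (by linarith : (4 / 3 - l) * (X ^ 2 - X * Y ^ 5 +
    1 / 3 * (Y ^ 4 - X ^ 3 * Y)) = 0)).resolve_left hw₁.ne'
  have e₂ := (mul_eq_zero.1 (by linarith : (l - 1 / 3) * (X ^ 2 - X * Y ^ 5 +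
    4 / 3 * (Y ^ 4 - X ^ 3 * Y)) = 0)).resolve_left hw₂.ne'
  have f₁ : X * (X - Y ^ 5) = 0 := by linarith
  have f₂ : Y * (Y ^ 3 - X ^ 3) = 0 := by linarith
  obtain rfl | hX0 := eq_or_ne X 0
  · have : Y = 0 := by simpa [← pow_succ'] using f₂
    simp [this]
  obtain rfl | hY0 := eq_or_ne Y 0
  · simp [hX0] at f₁
  exact ⟨sub_eq_zero.1 ((mul_eq_zero.1 f₂).resolve_left hY0),
    sub_eq_zero.1 ((mul_eq_zero.1 f₁).resolve_left hX0)⟩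

theorem IsPeriodicOrConnecting.bacciotti_eq_zero_of_moderate {m : ℝ} (hm : 3 / 5 ≤ m)
    (hm' : m ≤ 17 / 2) {γ : ℝ → ℝ × ℝ} (h : IsPeriodicOrConnecting m γ) (t : ℝ) :
    bacciotti m (γ t) = 0 := by
  have hm0 : 0 < m := by linarith
  obtain ⟨c, hc, hmc, hp, hp'⟩ := exists_pPlus_eq hm0
  have hc4 := pow_pos hc 4
  have hl : 1 / 3 < c ^ 2 := by nlinarith [sq_nonneg c]
  have hl' : c ^ 2 < 4 / 3 := by nlinarith [sq_nonneg c]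
  have hc' : c ≤ 8 / 7 := by
    refine le_of_pow_le_pow_left₀ (n := 4) (by norm_num) (by norm_num) ?_
    nlinarith
  have hq : ∀ t, 0 ≤ angular m (γ t).1 (γ t).2 ∧
      (angular m (γ t).1 (γ t).2 = 0 → bacciotti m (γ t) = 0) := fun t => by
    obtain ⟨X, Y, hX, hY, hx, hy⟩ := h.exists_scaled hm0 hc hmc hp hp' t
    have := angular_nonneg hX hY hl hl' (q := angular m (γ t).1 (γ t).2) (by
      simp only [angular, hx, hy]
      linear_combination (-c ^ 2 * X * Y ^ 5) * hmc)
    refine ⟨this.1, fun h0 => ?_⟩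
    obtain ⟨h₁, h₂⟩ := this.2 h0
    refine Prod.ext ?_ ?_
    · simp only [bacciotti, hx, hy, Prod.fst_zero]
      linear_combination c ^ 3 * h₁
    · simp only [bacciotti, hx, hy, Prod.snd_zero]
      linear_combination c * Y ^ 5 * hmc - c * h₂
  have hK : ∀ t, ((γ t).1 ^ 8 + (γ t).2 ^ 10) / 10000 ≤ divPoly (γ t).1 (γ t).2 +
      (m - 3 / 5) * (γ t).2 ^ 4 * divSlope (γ t).1 (γ t).2 := fun t => by
    obtain ⟨hx, hy⟩ := h.sq_le hm0 hmc hp hp' t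
    have hx := (abs_le_of_sq_le_sq hx hc.le).trans hc'
    have hy := (abs_le_of_sq_le_sq hy hc.le).trans hc'
    have hm1 : 0 ≤ m - 3 / 5 := by linarith
    have := mul_nonneg (by positivity : 0 ≤ (m - 3 / 5) * (γ t).2 ^ 4) (divSlope_nonneg hx hy)
    linarith [le_divPoly hx hy]
  have hnn : ∀ t, 0 ≤ ((γ t).1 ^ 8 + (γ t).2 ^ 10) / 10000 := fun t => by positivity
  have h0 := h.derivative_eq_zero (continuous_lyapunov m)
    (by simp only [hp, hp', lyapunov_neg_neg])
    (fun t => hasDerivAt_lyapunov (h.isSolution.hasDerivAt_fst_s15 t) (h.isSolution.hasDerivAt_snd_s15 t))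
    (fun t => mul_nonneg (hq t).1 ((hnn t).trans (hK t))) t
  obtain h0 | h0 := mul_eq_zero.1 h0
  · exact (hq t).2 h0
  · have hs : (γ t).1 ^ 8 + (γ t).2 ^ 10 = 0 := by linarith [hnn t, hK t]
    have hx8 : 0 ≤ (γ t).1 ^ 8 := by positivity
    have hy10 : 0 ≤ (γ t).2 ^ 10 := by positivity
    have hx : (γ t).1 = 0 := pow_eq_zero_iff (n := 8) (by norm_num) |>.1 (by linarith)
    have hy : (γ t).2 = 0 := pow_eq_zero_iff (n := 10) (by norm_num) |>.1 (by linarith)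
    simp [bacciotti, hx, hy]

theorem IsPeriodicOrConnecting.eq_const {m : ℝ} (hm : 3 / 5 ≤ m) {γ : ℝ → ℝ × ℝ}
    (h : IsPeriodicOrConnecting m γ) : ∃ p, ∀ t, γ t = p :=
  h.isSolution.eq_const fun t => (le_total m (17 / 2)).elim
    (fun hm' => h.bacciotti_eq_zero_of_moderate hm hm' t)
    fun hm' => h.bacciotti_eq_zero_of_large hm' t

theorem bacciotti_no_cycles_large_m (m : ℝ) (hm : 3 / 5 ≤ m) :
    (¬ ∃ (γ : ℝ → ℝ × ℝ) (T : ℝ), IsPeriodicOrbit m γ T) ∧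
    (¬ ∃ γ : ℝ → ℝ × ℝ, IsHeteroclinic m γ) := by
  constructor
  · rintro ⟨γ, T, hγ, hne, hT, hper⟩
    exact hne (IsPeriodicOrConnecting.eq_const hm (.inl ⟨hγ, T, hT, hper⟩))
  · rintro ⟨γ, hγ⟩
    obtain ⟨p, hp⟩ := IsPeriodicOrConnecting.eq_const hm (.inr hγ)
    obtain ⟨c, hc, -, hplus, hminus⟩ := exists_pPlus_eq (show 0 < m by linarith)
    obtain ⟨-, hbot, htop⟩ := hγ
    rw [funext hp, tendsto_const_nhds_iff] at hbot htop
    have := congrArg Prod.fst (hbot.symm.trans htop)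
    simp only [hplus, hminus] at this
    linarith

end
end
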